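/- Let n ≥ 1 and 0 < s < 1, and set α₀ = min(s, 1−s). Let Ω ⊂ ℝⁿ be a domain whose boundary is locally of class C^{1,1}, fix x₀ ∈ ∂Ω and write B_r = B_r(x₀). Let g ∈ L^∞(Ω ∩ B_4) and let u ∈ C^{1,1}_{loc}(Ω ∩ B_4) ∩ L_{2s} be nonnegative on ℝⁿ and a classical solution of (-Δ)^s u = g in Ω ∩ B_4 with u = 0 in B_4 \ Ω. Then ‖u‖_{C^{α₀}(Ω ∩ B_{1/2})} ≤ C (‖u‖_{L^∞(Ω ∩ B_4)} + ‖g‖_{L^∞(Ω ∩ B_4)}), where C depends only on n, s and the local C^{1,1} norm of ∂Ω. -/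

import Mathlib

open MeasureTheory Metric Set Filter
open scoped Topology NNReal ENNReal RealInnerProductSpace

noncomputable section

/-- `n`-dimensional Euclidean space `ℝⁿ`. -/
abbrev Euc (n : ℕ) := EuclideanSpace ℝ (Fin n)

/-- The standard normalization constant `C_{n,s}` of the fractional Laplacian,
`C_{n,s} = 4^s Γ(n/2+s) / (π^{n/2} |Γ(-s)|) = s·4^s·Γ(n/2+s) / (π^{n/2} Γ(1-s))`. -/
def fracC (n : ℕ) (s : ℝ) : ℝ :=
  s * 4 ^ s * Real.Gamma ((n : ℝ) / 2 + s) /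
    (Real.pi ^ ((n : ℝ) / 2) * Real.Gamma (1 - s))

/-- `(-Δ)^s u (x) = v` in the classical (Cauchy principal value) sense: the truncated
integrals `C_{n,s} ∫_{|x-y| ≥ ε} (u(x) - u(y))/|x-y|^{n+2s} dy` tend to `v` as `ε → 0⁺`. -/
def HasFracLapAt (n : ℕ) (s : ℝ) (u : Euc n → ℝ) (x : Euc n) (v : ℝ) : Prop :=
  Tendsto (fun ε : ℝ =>
      fracC n s *
        ∫ y in {y : Euc n | ε ≤ dist x y}, (u x - u y) / dist x y ^ ((n : ℝ) + 2 * s))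
    (𝓝[>] (0 : ℝ)) (𝓝 v)

/-- The tail space `L_{2s}`: locally integrable functions with
`∫_{ℝⁿ} |u(y)|/(1+|y|^{n+2s}) dy < ∞`. -/
def MemL2s (n : ℕ) (s : ℝ) (u : Euc n → ℝ) : Prop :=
  LocallyIntegrable u volume ∧
    Integrable (fun y : Euc n => |u y| / (1 + ‖y‖ ^ ((n : ℝ) + 2 * s))) volume

/-- The `L_{2s}` norm `‖u‖_{L_{2s}} = ∫_{ℝⁿ} |u(y)|/(1+|y|^{n+2s}) dy`. -/
def l2sNorm (n : ℕ) (s : ℝ) (u : Euc n → ℝ) : ℝ :=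
  ∫ y : Euc n, |u y| / (1 + ‖y‖ ^ ((n : ℝ) + 2 * s))

/-- `u ∈ C^{1,1}_{loc}(Ω)`: near every point of `Ω`, `u` is `C^1` with a Lipschitz
continuous derivative. -/
def C11LocOn (n : ℕ) (u : Euc n → ℝ) (Ω : Set (Euc n)) : Prop :=
  ∀ x ∈ Ω, ∃ ε > 0, ball x ε ⊆ Ω ∧ ContDiffOn ℝ 1 u (ball x ε) ∧
    ∃ L : ℝ≥0, LipschitzOnWith L (fun y => fderiv ℝ u y) (ball x ε)

/-- The `C^γ(K)` norm (`0 < γ < 1`) of `u` is bounded by `A`: both the sup norm and the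
`γ`-Hölder seminorm of `u` on `K` are at most `A`. -/
def HolderBoundOn (n : ℕ) (γ : ℝ) (u : Euc n → ℝ) (K : Set (Euc n)) (A : ℝ) : Prop :=
  (∀ x ∈ K, |u x| ≤ A) ∧ ∀ x ∈ K, ∀ y ∈ K, |u x - u y| ≤ A * dist x y ^ γ

/-- Two-sided (interior and exterior) tangent ball condition of radius `ρ` at a boundary
point `z` of `Ω`.  A uniform two-sided ball condition is the standard geometric
characterization of a (locally) `C^{1,1}` boundary: the radius `ρ` is controlled by the
local `C^{1,1}` norm of `∂Ω` and vice versa. -/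
def TwoSidedBallAt (n : ℕ) (Ω : Set (Euc n)) (ρ : ℝ) (z : Euc n) : Prop :=
  ∃ ν : Euc n, ‖ν‖ = 1 ∧ ball (z + ρ • ν) ρ ⊆ Ω ∧ ball (z - ρ • ν) ρ ⊆ Ωᶜ

/-- The kernel `‖z‖^{-(n+2s)}` of the fractional Laplacian. -/
def fracKer (n : ℕ) (s : ℝ) (z : Euc n) : ℝ := (‖z‖ ^ ((n : ℝ) + 2 * s))⁻¹

section Kernel

variable {n : ℕ} {s : ℝ}

theorem fracKer_nonneg (z : Euc n) : 0 ≤ fracKer n s z := by unfold fracKer; positivity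

theorem fracKer_neg (z : Euc n) : fracKer n s (-z) = fracKer n s z := by simp [fracKer]

theorem measurable_fracKer : Measurable (fracKer n s) := by unfold fracKer; fun_prop

theorem fracKer_zero (hs : 0 < s) : fracKer n s 0 = 0 := by
  have : (n : ℝ) + 2 * s ≠ 0 := by positivity
  simp [fracKer, Real.zero_rpow this]

theorem integrableOn_min_rpow {a b : ℝ} (ha : 2 * s < a) (hb : b < 2 * s) :
    IntegrableOn (fun r : ℝ => min (r ^ a) (r ^ b) * r ^ (-1 - 2 * s)) (Ioi 0) := by
  have hm : Measurable (fun r : ℝ => min (r ^ a) (r ^ b) * r ^ (-1 - 2 * s)) := by fun_prop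
  rw [← Ioc_union_Ioi_eq_Ioi (zero_le_one (α := ℝ))]
  refine IntegrableOn.union ?_ ?_
  · have h1 : IntegrableOn (fun r : ℝ => r ^ (a - 1 - 2 * s)) (Ioc 0 1) := by
      rw [← intervalIntegrable_iff_integrableOn_Ioc_of_le zero_le_one]
      exact intervalIntegral.intervalIntegrable_rpow' (by linarith)
    refine h1.mono' hm.aestronglyMeasurable ?_
    filter_upwards [ae_restrict_mem measurableSet_Ioc] with r hr
    have hr0 : 0 < r := hr.1
    rw [Real.norm_of_nonneg (by positivity)]
    calc _ ≤ r ^ a * r ^ (-1 - 2 * s) := by gcongr; exact min_le_left _ _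
      _ = _ := by rw [← Real.rpow_add hr0]; congr 1; ring
  · have h1 : IntegrableOn (fun r : ℝ => r ^ (b - 1 - 2 * s)) (Ioi 1) :=
      integrableOn_Ioi_rpow_of_lt (by linarith) one_pos
    refine h1.mono' hm.aestronglyMeasurable ?_
    filter_upwards [ae_restrict_mem measurableSet_Ioi] with r hr
    have hr0 : 0 < r := lt_trans one_pos hr
    rw [Real.norm_of_nonneg (by positivity)]
    calc _ ≤ r ^ b * r ^ (-1 - 2 * s) := by gcongr; exact min_le_right _ _
      _ = _ := by rw [← Real.rpow_add hr0]; congr 1; ring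

theorem integrable_min_rpow_ker (hn : 1 ≤ n) {a b : ℝ} (ha : 2 * s < a) (hb : b < 2 * s) :
    Integrable (fun z : Euc n => min (‖z‖ ^ a) (‖z‖ ^ b) * fracKer n s z) := by
  have : Nonempty (Fin n) := ⟨⟨0, hn⟩⟩
  have : Nontrivial (Euc n) := inferInstance
  have := (integrable_fun_norm_addHaar (E := Euc n) (volume : Measure (Euc n))
    (f := fun r : ℝ => min (r ^ a) (r ^ b) * (r ^ ((n : ℝ) + 2 * s))⁻¹)).2 (by
      refine (integrableOn_min_rpow ha hb).congr_fun (fun r hr => ?_) measurableSet_Ioi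
      have hr0 : 0 < r := hr
      have : r ^ (-1 - 2 * s) = r ^ (n - 1) * (r ^ ((n : ℝ) + 2 * s))⁻¹ := by
        rw [← Real.rpow_neg hr0.le, ← Real.rpow_natCast, ← Real.rpow_add hr0]
        congr 1
        push_cast [hn]
        ring
      simp only [finrank_euclideanSpace, Fintype.card_fin, smul_eq_mul]
      rw [this]; ring)
  exact this

theorem integrable_min_sq_ker (hn : 1 ≤ n) (hs0 : 0 < s) (hs1 : s < 1) :
    Integrable (fun z : Euc n => min (‖z‖ ^ 2) 1 * fracKer n s z) := by
  have := integrable_min_rpow_ker (n := n) (s := s) hn (a := 2) (b := 0) (by linarith) (by linarith)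
  simpa using this

theorem integrable_of_le_min_sq (hn : 1 ≤ n) (hs0 : 0 < s) (hs1 : s < 1) {h : Euc n → ℝ} {C : ℝ}
    (hm : AEStronglyMeasurable h) (hC : ∀ z, |h z| ≤ C * min (‖z‖ ^ 2) 1) :
    Integrable (fun z => h z * fracKer n s z) := by
  refine ((integrable_min_sq_ker (s := s) hn hs0 hs1).const_mul C).mono'
    (hm.mul measurable_fracKer.aestronglyMeasurable) (.of_forall fun z => ?_)
  rw [norm_mul, Real.norm_eq_abs, Real.norm_of_nonneg (fracKer_nonneg z), ← mul_assoc]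
  exact mul_le_mul_of_nonneg_right (hC z) (fracKer_nonneg z)

theorem measurableSet_le_norm (ε : ℝ) : MeasurableSet {z : Euc n | ε ≤ ‖z‖} :=
  measurableSet_le measurable_const measurable_norm

theorem integrableOn_bdd_ker (hn : 1 ≤ n) (hs0 : 0 < s) (hs1 : s < 1) {f : Euc n → ℝ} {C : ℝ}
    (hm : AEStronglyMeasurable f) (hC : ∀ z, |f z| ≤ C) {ε : ℝ} (hε : 0 < ε) :
    IntegrableOn (fun z => f z * fracKer n s z) {z | ε ≤ ‖z‖} := by
  have hC0 : 0 ≤ C := (abs_nonneg _).trans (hC 0)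
  rw [← integrable_indicator_iff (measurableSet_le_norm ε)]
  have := integrable_of_le_min_sq (s := s) hn hs0 hs1 (h := indicator {z : Euc n | ε ≤ ‖z‖} f)
    (C := C * (min (ε ^ 2) 1)⁻¹) (hm.indicator (measurableSet_le_norm ε)) (fun z => by
      by_cases hz : ε ≤ ‖z‖
      · rw [indicator_of_mem (by exact hz)]
        have h1 : min (ε ^ 2) 1 ≤ min (‖z‖ ^ 2) 1 := min_le_min_right _ (by gcongr)
        have h2 : 0 < min (ε ^ 2) 1 := by positivity
        calc |f z| ≤ C * 1 := by simpa using hC z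
          _ = C * ((min (ε ^ 2) 1)⁻¹ * min (ε ^ 2) 1) := by rw [inv_mul_cancel₀ h2.ne']
          _ ≤ C * ((min (ε ^ 2) 1)⁻¹ * min (‖z‖ ^ 2) 1) := by gcongr
          _ = _ := by ring
      · rw [indicator_of_notMem (by exact hz)]
        simp only [abs_zero]; positivity)
  refine this.congr (.of_forall fun z => ?_)
  by_cases hz : z ∈ {z : Euc n | ε ≤ ‖z‖} <;> simp [hz]

theorem integral_min_sq_div_ker {d : ℝ} (hd : 0 < d) :
    ∫ z : Euc n, min (‖z‖ ^ 2 / d ^ 2) 1 * fracKer n s z =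
      d ^ (-(2 * s)) * ∫ z : Euc n, min (‖z‖ ^ 2) 1 * fracKer n s z := by
  have := Measure.integral_comp_smul (volume : Measure (Euc n))
    (fun z : Euc n => min (‖z‖ ^ 2 / d ^ 2) 1 * fracKer n s z) d
  have hk : ∀ z : Euc n, min (‖d • z‖ ^ 2 / d ^ 2) 1 * fracKer n s (d • z) =
      d ^ (-((n : ℝ) + 2 * s)) * (min (‖z‖ ^ 2) 1 * fracKer n s z) := by
    intro z
    rw [norm_smul, Real.norm_of_nonneg hd.le, mul_pow, mul_div_cancel_left₀ _ (by positivity)]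
    unfold fracKer
    rw [norm_smul, Real.norm_of_nonneg hd.le, Real.mul_rpow hd.le (norm_nonneg _), mul_inv,
      Real.rpow_neg hd.le]
    ring
  simp only [hk, integral_const_mul, finrank_euclideanSpace, Fintype.card_fin, smul_eq_mul] at this
  rw [abs_of_pos (by positivity)] at this
  rw [Real.rpow_neg hd.le, Real.rpow_add hd, Real.rpow_natCast] at this
  rw [Real.rpow_neg hd.le]
  field_simp at this ⊢
  linarith

/-- A lower bound for kernel integrals of functions that are large on a ball. -/
theorem le_integral_ker_of_ball (hs0 : 0 < s) {h : Euc n → ℝ} (h0 : ∀ z, 0 ≤ h z)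
    (hi : Integrable (fun z => h z * fracKer n s z)) {a : Euc n} {r R c : ℝ} (hr : 0 < r)
    (hball : ∀ z ∈ ball a r, c ≤ h z ∧ 0 < ‖z‖ ∧ ‖z‖ ≤ R) :
    c * (volume.real (ball (0 : Euc n) 1) * r ^ n * R ^ (-((n : ℝ) + 2 * s))) ≤
      ∫ z, h z * fracKer n s z := by
  have hvol : volume.real (ball a r) = volume.real (ball (0 : Euc n) 1) * r ^ n := by
    rw [Measure.real, Measure.addHaar_ball_of_pos volume a hr, ENNReal.toReal_mul,
      ENNReal.toReal_ofReal (by positivity), finrank_euclideanSpace, Fintype.card_fin, mul_comm]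
    rfl
  have hR : 0 ≤ R := ((hball a (mem_ball_self hr)).2.1.le).trans (hball a (mem_ball_self hr)).2.2
  calc _ = ∫ z in ball a r, c * R ^ (-((n : ℝ) + 2 * s)) := by
        rw [setIntegral_const, hvol, smul_eq_mul]; ring
    _ ≤ ∫ z in ball a r, h z * fracKer n s z := by
        refine setIntegral_mono_on (integrableOn_const measure_ball_lt_top.ne) hi.integrableOn
          measurableSet_ball fun z hz => ?_
        obtain ⟨h1, h2, h3⟩ := hball z hz
        have : R ^ (-((n : ℝ) + 2 * s)) ≤ fracKer n s z := by
          unfold fracKer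
          rw [Real.rpow_neg hR]
          gcongr
        have := fracKer_nonneg (n := n) (s := s) z
        have : 0 ≤ R ^ (-((n : ℝ) + 2 * s)) := by positivity
        gcongr
        exact h0 z
    _ ≤ _ := setIntegral_le_integral hi
        (.of_forall fun z => mul_nonneg (h0 z) (fracKer_nonneg z))

theorem tendsto_trunc_integral (hs0 : 0 < s) {h : Euc n → ℝ}
    (hi : Integrable (fun z => h z * fracKer n s z)) :
    Tendsto (fun ε : ℝ => ∫ z in {z : Euc n | ε ≤ ‖z‖}, h z * fracKer n s z) (𝓝[>] 0)
      (𝓝 (∫ z, h z * fracKer n s z)) := by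
  simp_rw [← integral_indicator (measurableSet_le_norm _)]
  refine tendsto_integral_filter_of_dominated_convergence (fun z => ‖h z * fracKer n s z‖)
    (.of_forall fun ε => hi.aestronglyMeasurable.indicator (measurableSet_le_norm ε))
    (.of_forall fun ε => .of_forall fun z => norm_indicator_le_norm_self _ _) hi.norm
    (.of_forall fun z => ?_)
  rcases eq_or_ne z 0 with rfl | hz
  · have : ∀ ε, indicator {z : Euc n | ε ≤ ‖z‖} (fun z => h z * fracKer n s z) 0 = 0 := by
      intro ε
      simp [indicator, fracKer_zero hs0]
    simp [this, fracKer_zero hs0]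
  · refine tendsto_const_nhds.congr' ?_
    filter_upwards [Ioo_mem_nhdsGT (norm_pos_iff.2 hz)] with ε hε
    rw [indicator_of_mem (by exact hε.2.le)]

theorem setIntegral_trunc_neg (f : Euc n → ℝ) (ε : ℝ) :
    ∫ z in {z : Euc n | ε ≤ ‖z‖}, f (-z) * fracKer n s z =
      ∫ z in {z : Euc n | ε ≤ ‖z‖}, f z * fracKer n s z := by
  rw [← integral_indicator (measurableSet_le_norm _), ← integral_indicator (measurableSet_le_norm _),
    ← integral_neg_eq_self]
  congr 1 with z
  simp [indicator, fracKer_neg]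

theorem integrableOn_trunc_neg {f : Euc n → ℝ} {ε : ℝ}
    (hf : IntegrableOn (fun z => f z * fracKer n s z) {z | ε ≤ ‖z‖}) :
    IntegrableOn (fun z => f (-z) * fracKer n s z) {z | ε ≤ ‖z‖} := by
  rw [← integrable_indicator_iff (measurableSet_le_norm _)] at hf ⊢
  refine hf.comp_neg.congr (.of_forall fun z => ?_)
  simp [indicator, fracKer_neg]

/-- A principal value is bounded below by the integral of any absolutely integrable minorant of
the symmetrized integrand. -/
theorem integral_le_of_tendsto_trunc (hs0 : 0 < s) {f h : Euc n → ℝ} {v : ℝ}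
    (hf : ∀ ε > 0, IntegrableOn (fun z => f z * fracKer n s z) {z | ε ≤ ‖z‖})
    (hlim : Tendsto (fun ε : ℝ => ∫ z in {z : Euc n | ε ≤ ‖z‖}, f z * fracKer n s z) (𝓝[>] 0) (𝓝 v))
    (hi : Integrable (fun z => h z * fracKer n s z)) (hle : ∀ z, 2 * h z ≤ f z + f (-z)) :
    ∫ z, h z * fracKer n s z ≤ v := by
  refine le_of_tendsto_of_tendsto (tendsto_trunc_integral hs0 hi) hlim ?_
  filter_upwards [self_mem_nhdsWithin] with ε hε
  have h1 := hf ε hε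
  have h2 := integrableOn_trunc_neg h1
  have h3 : ∫ z in {z : Euc n | ε ≤ ‖z‖}, 2 * (h z * fracKer n s z) ≤
      ∫ z in {z : Euc n | ε ≤ ‖z‖}, (f z * fracKer n s z + f (-z) * fracKer n s z) := by
    refine integral_mono (hi.integrableOn.const_mul 2) (h1.add h2) fun z => ?_
    have := mul_le_mul_of_nonneg_right (hle z) (fracKer_nonneg (n := n) (s := s) z)
    linarith
  rw [integral_add h1 h2, setIntegral_trunc_neg, integral_const_mul] at h3
  linarith

end Kernel

/-- The symmetric second difference at `1` of the truncated power `t ↦ t_+^γ`, with step `x`. -/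
def powDiff (γ x : ℝ) : ℝ := 2 - max (1 + x) 0 ^ γ - max (1 - x) 0 ^ γ

section PowDiff

theorem powDiff_zero (γ : ℝ) : powDiff γ 0 = 0 := by norm_num [powDiff]

theorem powDiff_neg (γ x : ℝ) : powDiff γ (-x) = powDiff γ x := by
  unfold powDiff; rw [sub_neg_eq_add, ← sub_eq_add_neg]; ring

theorem measurable_powDiff (γ : ℝ) : Measurable (powDiff γ) := by unfold powDiff; fun_prop

theorem posPart_rpow_le {γ : ℝ} (h0 : 0 < γ) (h2 : γ ≤ 2) (x : ℝ) :
    max (1 + x) 0 ^ γ ≤ 1 + γ / 2 * (2 * x + x ^ 2) := by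
  calc max (1 + x) 0 ^ γ ≤ |1 + x| ^ γ := by
        gcongr
        exact max_le (le_abs_self _) (abs_nonneg _)
    _ = (1 + (2 * x + x ^ 2)) ^ (γ / 2) := by
        rw [show 1 + (2 * x + x ^ 2) = |1 + x| ^ 2 by rw [sq_abs]; ring, ← Real.rpow_natCast,
          ← Real.rpow_mul (abs_nonneg _)]
        congr 1; push_cast; ring
    _ ≤ _ := rpow_one_add_le_one_add_mul_self (by nlinarith [sq_nonneg (x + 1)])
        (by linarith) (by linarith)

theorem neg_two_mul_sq_le_powDiff {γ : ℝ} (h0 : 0 < γ) (h2 : γ ≤ 2) (x : ℝ) :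
    -(2 * x ^ 2) ≤ powDiff γ x := by
  have h1 := posPart_rpow_le h0 h2 x
  have h3 := posPart_rpow_le h0 h2 (-x)
  unfold powDiff
  rw [sub_eq_add_neg 1 x]
  nlinarith [sq_nonneg x]

theorem powDiff_le_two_mul_sq {γ : ℝ} (h2 : γ ≤ 2) {x : ℝ} (hx : |x| ≤ 1) :
    powDiff γ x ≤ 2 * x ^ 2 := by
  obtain ⟨hx1, hx2⟩ := abs_le.1 hx
  unfold powDiff
  rw [max_eq_left (by linarith), max_eq_left (by linarith)]
  have hsq : ∀ y : ℝ, 0 ≤ y → y ^ γ = (y ^ (γ / 2)) ^ 2 := fun y hy => by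
    rw [← Real.rpow_natCast, ← Real.rpow_mul hy]; congr 1; push_cast; ring
  rw [hsq _ (by linarith), hsq (1 - x) (by linarith)]
  have h1 : (1 - x ^ 2) ≤ (1 + x) ^ (γ / 2) * (1 - x) ^ (γ / 2) := by
    rw [← Real.mul_rpow (by linarith) (by linarith), show (1 + x) * (1 - x) = 1 - x ^ 2 by ring]
    have : x ^ 2 ≤ 1 := by nlinarith
    calc 1 - x ^ 2 = (1 - x ^ 2) ^ (1 : ℝ) := by rw [Real.rpow_one]
      _ ≤ _ := Real.rpow_le_rpow_of_exponent_ge_of_imp (by linarith) (by nlinarith) (by linarith)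
        (fun _ h => by linarith)
  nlinarith [sq_nonneg ((1 + x) ^ (γ / 2) - (1 - x) ^ (γ / 2))]

theorem abs_powDiff_le {γ : ℝ} (h0 : 0 < γ) (h2 : γ ≤ 2) (x : ℝ) :
    |powDiff γ x| ≤ 10 * min (|x| ^ (2 : ℝ)) (|x| ^ γ) := by
  rcases le_total |x| 1 with hx | hx
  · have h1 := neg_two_mul_sq_le_powDiff h0 h2 x
    have h3 := powDiff_le_two_mul_sq h2 hx
    have : |x| ^ (2 : ℝ) ≤ |x| ^ γ :=
      Real.rpow_le_rpow_of_exponent_ge_of_imp (abs_nonneg _) hx h2 (fun _ h => by linarith)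
    rw [min_eq_left this, Real.rpow_two, sq_abs, abs_le]
    constructor <;> nlinarith [sq_nonneg x]
  · have : |x| ^ γ ≤ |x| ^ (2 : ℝ) := Real.rpow_le_rpow_of_exponent_le hx h2
    rw [min_eq_right this]
    have h1 : 1 ≤ |x| ^ γ := Real.one_le_rpow hx h0.le
    have hb : ∀ y : ℝ, y ≤ 1 + |x| → max y 0 ^ γ ≤ 4 * |x| ^ γ := fun y hy => by
      calc max y 0 ^ γ ≤ (2 * |x|) ^ γ := by
            gcongr
            exact max_le (by linarith) (by positivity)
        _ = 2 ^ γ * |x| ^ γ := Real.mul_rpow (by norm_num) (abs_nonneg _)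
        _ ≤ 2 ^ (2 : ℝ) * |x| ^ γ := by gcongr; norm_num
        _ = _ := by norm_num
    have h3 := hb (1 + x) (by linarith [le_abs_self x])
    have h4 := hb (1 - x) (by linarith [neg_abs_le x])
    have h5 : 0 ≤ max (1 + x) 0 ^ γ := by positivity
    have h6 : 0 ≤ max (1 - x) 0 ^ γ := by positivity
    unfold powDiff
    rw [abs_le]
    constructor <;> linarith

theorem integrableOn_powDiff {s γ : ℝ} (hs1 : s < 1) (h0 : 0 < γ) (hγ : γ < 2 * s) :
    IntegrableOn (fun r : ℝ => powDiff γ r * r ^ (-1 - 2 * s)) (Ioi 0) := by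
  refine ((integrableOn_min_rpow (s := s) (a := 2) (b := γ) (by linarith) hγ).const_mul 10).mono'
    ((measurable_powDiff γ).mul (by fun_prop)).aestronglyMeasurable ?_
  filter_upwards [ae_restrict_mem measurableSet_Ioi] with r hr
  have hr0 : 0 < r := hr
  rw [norm_mul, Real.norm_eq_abs, Real.norm_of_nonneg (by positivity), ← mul_assoc]
  gcongr
  simpa [abs_of_pos hr0] using abs_powDiff_le h0 (by linarith) r

/-- For `0 < s < 1` the function `x_+^s` is `s`-harmonic on the positive half-line. The proof
transplants `(0, 1)` to `(0, ∞)` by `τ ↦ τ / (1 + τ)`; the sum of the two pieces then has the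
antiderivative `-τ^{-2s} ((1 + τ)^s - 1)² / (2s)`. -/
theorem integral_powDiff_self {s : ℝ} (hs0 : 0 < s) (hs1 : s < 1) :
    ∫ r in Ioi (0 : ℝ), powDiff s r * r ^ (-1 - 2 * s) = 0 := by
  set m : ℝ → ℝ := fun r => (1 - max (1 - r) 0 ^ s) * r ^ (-1 - 2 * s) with hm
  set a : ℝ → ℝ := fun r => (1 - max (1 + r) 0 ^ s) * r ^ (-1 - 2 * s) with ha
  set G : ℝ → ℝ := fun r => -(r ^ (-(2 * s)) * ((1 + r) ^ s - 1) ^ 2 / (2 * s)) with hG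
  set σ : ℝ → ℝ := fun r => r / (1 + r) with hσ
  have hcm : ContinuousOn m (Ioi 0) := fun r hr => by
    refine ContinuousAt.continuousWithinAt ?_
    have hr0 : r ≠ 0 := ne_of_gt hr
    exact (continuousAt_const.sub (((continuousAt_const.sub continuousAt_id).max
      continuousAt_const).rpow_const (Or.inr hs0.le))).mul
      (continuousAt_id.rpow_const (Or.inl hr0))
  have hca : ContinuousOn a (Ioi 0) := fun r hr => by
    refine ContinuousAt.continuousWithinAt ?_
    have hr0 : r ≠ 0 := ne_of_gt hr
    exact (continuousAt_const.sub (((continuousAt_const.add continuousAt_id).max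
      continuousAt_const).rpow_const (Or.inr hs0.le))).mul
      (continuousAt_id.rpow_const (Or.inl hr0))
  have hσd : ∀ r > 0, HasDerivAt σ ((1 + r) ^ (-2 : ℝ)) r := fun r hr => by
    have := (hasDerivAt_id r).div ((hasDerivAt_id r).const_add 1) (by simp; positivity)
    refine this.congr_deriv ?_
    simp only [id]
    rw [Real.rpow_neg (by positivity), Real.rpow_two]
    field_simp
    ring
  have hGd : ∀ r > 0, HasDerivAt G (a r + m (σ r) * (1 + r) ^ (-2 : ℝ)) r := fun r hr => by
    have h1 : HasDerivAt (fun r : ℝ => r ^ (-(2 * s))) (-(2 * s) * r ^ (-(2 * s) - 1)) r :=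
      Real.hasDerivAt_rpow_const (Or.inl hr.ne')
    have h2 : HasDerivAt (fun r : ℝ => (1 + r) ^ s) (s * (1 + r) ^ (s - 1)) r := by
      have := ((hasDerivAt_id r).const_add 1).rpow_const (p := s) (Or.inl (by simp; positivity))
      simpa using this
    have h3 := ((h1.mul ((h2.sub_const 1).pow 2)).div_const (2 * s)).neg
    refine h3.congr_deriv ?_
    have h1r : 0 < 1 + r := by positivity
    have e1 : 1 - σ r = (1 + r)⁻¹ := by simp only [hσ]; field_simp; ring
    have hX : (1 + r) ^ (s - 1) = (1 + r) ^ s / (1 + r) := by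
      rw [Real.rpow_sub h1r, Real.rpow_one]
    have hr1 : r ^ (-(2 * s) - 1) = r ^ (-(2 * s)) / r := by rw [Real.rpow_sub hr, Real.rpow_one]
    have hr2 : r ^ (-1 - 2 * s) = r ^ (-(2 * s)) / r := by rw [← hr1]; congr 1; ring
    have h22 : (1 + r) ^ (-2 : ℝ) = ((1 + r) ^ 2)⁻¹ := by
      rw [Real.rpow_neg h1r.le, Real.rpow_two]
    have hσp : (σ r) ^ (-1 - 2 * s) = r ^ (-(2 * s)) / r * ((1 + r) * ((1 + r) ^ s) ^ 2) := by
      simp only [hσ]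
      rw [Real.div_rpow hr.le h1r.le, hr2, div_eq_mul_inv, ← Real.rpow_neg h1r.le]
      congr 1
      rw [← Real.rpow_natCast, ← Real.rpow_mul h1r.le]
      nth_rewrite 2 [← Real.rpow_one (1 + r)]
      rw [← Real.rpow_add h1r]
      congr 1; push_cast; ring
    simp only [ha, hm]
    rw [e1, max_eq_left (by positivity), max_eq_left (by positivity), Real.inv_rpow h1r.le,
      hσp, hX, hr1, hr2, h22]
    have hY : 0 < (1 + r) ^ s := by positivity
    simp only [Nat.cast_ofNat, Nat.add_one_sub_one, pow_one, Pi.pow_apply]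
    field_simp
    ring
  have hpos : ∀ {x y : ℝ}, 0 < x → 0 < y → uIcc x y ⊆ Ioi 0 := fun hx hy z hz =>
    lt_of_lt_of_le (lt_min hx hy) hz.1
  have hσpos : ∀ {x : ℝ}, 0 < x → 0 < σ x := fun hx => by simp only [hσ]; positivity
  have key : ∀ ε R : ℝ, 0 < ε → 0 < R → ∫ r in ε..R, powDiff s r * r ^ (-1 - 2 * s) =
      G R - G ε + ((∫ r in σ R..R, m r) - ∫ r in σ ε..ε, m r) := by
    intro ε R hε hR
    have him : ∀ {x y : ℝ}, 0 < x → 0 < y → IntervalIntegrable m volume x y := fun hx hy =>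
      (hcm.mono (hpos hx hy)).intervalIntegrable
    have hia : IntervalIntegrable a volume ε R := (hca.mono (hpos hε hR)).intervalIntegrable
    have hcσ : ContinuousOn σ (Ioi 0) := fun r hr => (hσd r hr).continuousAt.continuousWithinAt
    have hcd : ContinuousOn (fun r : ℝ => (1 + r) ^ (-2 : ℝ)) (Ioi 0) := fun r hr =>
      ((continuousAt_const.add continuousAt_id).rpow_const
        (Or.inl (ne_of_gt (add_pos one_pos hr)))).continuousWithinAt
    have hcmσ : ContinuousOn (fun r => m (σ r) * (1 + r) ^ (-2 : ℝ)) (Ioi 0) :=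
      (hcm.comp hcσ fun r hr => hσpos hr).mul hcd
    have himσ : IntervalIntegrable (fun r => m (σ r) * (1 + r) ^ (-2 : ℝ)) volume ε R :=
      (hcmσ.mono (hpos hε hR)).intervalIntegrable
    have h1 : ∫ r in ε..R, (a r + m (σ r) * (1 + r) ^ (-2 : ℝ)) = G R - G ε :=
      intervalIntegral.integral_eq_sub_of_hasDerivAt (fun r hr => hGd r (hpos hε hR hr))
        (hia.add himσ)
    have h2 : ∫ r in ε..R, m (σ r) * (1 + r) ^ (-2 : ℝ) = ∫ r in σ ε..σ R, m r :=
      intervalIntegral.integral_comp_mul_deriv'' (hcσ.mono (hpos hε hR))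
        (fun r hr => (hσd r (hpos hε hR (Ioo_subset_Icc_self hr))).hasDerivWithinAt)
        (hcd.mono (hpos hε hR))
        (hcm.mono (by rintro _ ⟨r, hr, rfl⟩; exact hσpos (hpos hε hR hr)))
    rw [intervalIntegral.integral_add hia himσ, h2] at h1
    have h3 : ∫ r in ε..R, powDiff s r * r ^ (-1 - 2 * s) =
        (∫ r in ε..R, a r) + ∫ r in ε..R, m r := by
      rw [← intervalIntegral.integral_add hia (him hε hR)]
      congr 1 with r
      simp only [ha, hm, powDiff]; ring
    have h4 := intervalIntegral.integral_interval_sub_interval_comm (him hε hR)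
      (him (hσpos hε) (hσpos hR)) (him hε (hσpos hε))
    have h5 := intervalIntegral.integral_symm (μ := volume) (f := m) ε (σ ε)
    have h6 := intervalIntegral.integral_symm (μ := volume) (f := m) R (σ R)
    rw [h3]
    linarith
  have hm0 : ∀ r ∈ Ioc (0 : ℝ) 1, 0 ≤ m r ∧ m r ≤ r ^ (-(2 * s)) := by
    rintro r ⟨hr0, hr1⟩
    have h1 : (1 - r) ^ s ≤ 1 := Real.rpow_le_one (by linarith) (by linarith) hs0.le
    have h2 : 1 - r ≤ (1 - r) ^ s := by
      calc 1 - r = (1 - r) ^ (1 : ℝ) := by rw [Real.rpow_one]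
        _ ≤ _ := Real.rpow_le_rpow_of_exponent_ge_of_imp (by linarith) (by linarith) hs1.le
          (fun _ h => by linarith)
    simp only [hm]
    rw [max_eq_left (by linarith)]
    refine ⟨mul_nonneg (by linarith) (by positivity), ?_⟩
    calc _ ≤ r * r ^ (-1 - 2 * s) := by gcongr; linarith
      _ = r ^ (1 + (-1 - 2 * s)) := by rw [Real.rpow_add hr0, Real.rpow_one]
      _ = _ := by congr 1; ring
  have hlim1 : Tendsto (fun R : ℝ => ∫ r in R⁻¹..R, powDiff s r * r ^ (-1 - 2 * s)) atTop
      (𝓝 (∫ r in Ioi (0 : ℝ), powDiff s r * r ^ (-1 - 2 * s))) := by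
    have hc : AECover (volume.restrict (Ioi (0 : ℝ))) atTop (fun R : ℝ => Ioi R⁻¹ ∩ Iic R) :=
      (aecover_Ioi_of_Ioi tendsto_inv_atTop_zero).inter (aecover_Iic tendsto_id)
    have := hc.integral_tendsto_of_countably_generated (integrableOn_powDiff hs1 hs0 (by linarith))
    refine this.congr' ?_
    filter_upwards [eventually_ge_atTop 1] with R hR
    rw [intervalIntegral.integral_of_le ((inv_le_one_of_one_le₀ hR).trans hR),
      Measure.restrict_restrict (measurableSet_Ioi.inter measurableSet_Iic)]
    congr 2
    ext r
    simp only [mem_inter_iff, mem_Ioi, mem_Iic, mem_Ioc]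
    have : 0 < R⁻¹ := by positivity
    constructor
    · tauto
    · rintro ⟨h1, h2⟩; exact ⟨⟨h1, h2⟩, by linarith⟩
  have hrp : Tendsto (fun R : ℝ => R ^ (-(2 - 2 * s))) atTop (𝓝 0) :=
    tendsto_rpow_neg_atTop (by linarith)
  have hG1 : Tendsto G atTop (𝓝 (-(1 / (2 * s)))) := by
    have h1 : Tendsto (fun R : ℝ => -(((1 + R⁻¹) ^ s - R ^ (-s)) ^ 2 / (2 * s))) atTop
        (𝓝 (-(((1 + 0) ^ s - 0) ^ 2 / (2 * s)))) := by
      refine ((((tendsto_inv_atTop_zero.const_add 1).rpow_const (Or.inr hs0.le)).sub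
        (tendsto_rpow_neg_atTop hs0)).pow 2).div_const _ |>.neg
    have h2 : -(((1 + (0 : ℝ)) ^ s - 0) ^ 2 / (2 * s)) = -(1 / (2 * s)) := by simp
    rw [h2] at h1
    refine h1.congr' ?_
    filter_upwards [eventually_gt_atTop 0] with R hR
    simp only [hG]
    have e1 : 1 + R⁻¹ = (1 + R) / R := by field_simp; ring
    have e2 : R ^ (-(2 * s)) = (R ^ (-s)) ^ 2 := by
      rw [← Real.rpow_natCast, ← Real.rpow_mul hR.le]; congr 1; push_cast; ring
    rw [e1, Real.div_rpow (by positivity) hR.le, e2, Real.rpow_neg hR.le]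
    field_simp
  have hG0 : Tendsto (fun R : ℝ => G R⁻¹) atTop (𝓝 0) := by
    have h0 : Tendsto (fun R : ℝ => -(R ^ (-(2 - 2 * s)) / (2 * s))) atTop (𝓝 0) := by
      simpa using (hrp.div_const (2 * s)).neg
    refine tendsto_of_tendsto_of_tendsto_of_le_of_le' h0 tendsto_const_nhds ?_ ?_
    · filter_upwards [eventually_gt_atTop 0] with R hR
      have h1 : (1 + R⁻¹) ^ s ≤ 1 + s * R⁻¹ := rpow_one_add_le_one_add_mul_self
        (by have : 0 < R⁻¹ := by positivity
            linarith) hs0.le hs1.le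
      have h2 : 1 ≤ (1 + R⁻¹) ^ s := Real.one_le_rpow (by simp [hR.le]) hs0.le
      have h3 : 0 < R⁻¹ := by positivity
      have h4 : ((1 + R⁻¹) ^ s - 1) ^ 2 ≤ R⁻¹ ^ 2 := by
        apply pow_le_pow_left₀ (by linarith)
        nlinarith
      simp only [hG]
      gcongr
      calc _ ≤ R⁻¹ ^ (-(2 * s)) * R⁻¹ ^ 2 := by gcongr
        _ = R⁻¹ ^ (2 - 2 * s) := by
          rw [← Real.rpow_natCast, ← Real.rpow_add h3]; congr 1; push_cast; ring
        _ = _ := by rw [Real.rpow_neg hR.le, Real.inv_rpow hR.le]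
    · filter_upwards [eventually_gt_atTop 0] with R hR
      simp only [hG]
      have : 0 < R⁻¹ := by positivity
      rw [neg_nonpos]
      positivity
  have hσ1 : ∀ r, 0 < r → σ r ≤ 1 := fun r hr => by
    simp only [hσ]; rw [div_le_one (by positivity)]; linarith
  have hσr : ∀ r, 0 < r → σ r ≤ r := fun r hr => by
    simp only [hσ]; exact div_le_self hr.le (by linarith)
  have hme : Tendsto (fun R : ℝ => ∫ r in σ R⁻¹..R⁻¹, m r) atTop (𝓝 0) := by
    have h0 : Tendsto (fun R : ℝ => 4 * R ^ (-(2 - 2 * s))) atTop (𝓝 0) := by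
      simpa using hrp.const_mul 4
    refine squeeze_zero_norm' ?_ h0
    filter_upwards [eventually_ge_atTop 1] with R hR
    have hR0 : 0 < R := by linarith
    set e := R⁻¹ with he
    have he0 : 0 < e := by positivity
    have he1 : e ≤ 1 := inv_le_one_of_one_le₀ hR
    have hσe : e / 2 ≤ σ e := by simp only [hσ]; gcongr; linarith
    have hb : ∀ r ∈ uIoc (σ e) e, ‖m r‖ ≤ 4 * e ^ (-(2 * s)) := by
      intro r hr
      rw [uIoc_of_le (hσr e he0)] at hr
      have hr0 : 0 < r := (hσpos he0).trans hr.1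
      obtain ⟨h1, h2⟩ := hm0 r ⟨hr0, hr.2.trans he1⟩
      rw [Real.norm_of_nonneg h1]
      calc m r ≤ r ^ (-(2 * s)) := h2
        _ ≤ (e / 2) ^ (-(2 * s)) := by
          apply Real.rpow_le_rpow_of_nonpos (by positivity) (hσe.trans hr.1.le); linarith
        _ = 2 ^ (2 * s) * e ^ (-(2 * s)) := by
          rw [Real.div_rpow he0.le (by norm_num), Real.rpow_neg (by norm_num : (0:ℝ) ≤ 2)]
          field_simp
        _ ≤ 2 ^ (2 : ℝ) * e ^ (-(2 * s)) := by gcongr <;> linarith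
        _ = _ := by norm_num
    have := intervalIntegral.norm_integral_le_of_norm_le_const hb
    refine this.trans ?_
    rw [abs_of_nonneg (by linarith [hσr e he0])]
    have h5 : e - σ e ≤ e ^ 2 := by
      have : e - σ e = e ^ 2 / (1 + e) := by simp only [hσ]; field_simp; ring
      rw [this]
      exact div_le_self (by positivity) (by linarith)
    calc _ ≤ 4 * e ^ (-(2 * s)) * e ^ 2 := by gcongr
      _ = 4 * e ^ (2 - 2 * s) := by
        rw [mul_assoc, ← Real.rpow_natCast, ← Real.rpow_add he0]; congr 2; push_cast; ring
      _ = _ := by rw [Real.rpow_neg hR0.le, he, Real.inv_rpow hR0.le]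
  have hmR : Tendsto (fun R : ℝ => ∫ r in σ R..1, m r) atTop (𝓝 0) := by
    have h0 : Tendsto (fun R : ℝ => 4 * R⁻¹) atTop (𝓝 0) := by
      simpa using tendsto_inv_atTop_zero.const_mul (4 : ℝ)
    refine squeeze_zero_norm' ?_ h0
    filter_upwards [eventually_ge_atTop 1] with R hR
    have hR0 : 0 < R := by linarith
    have hσe : 1 / 2 ≤ σ R := by
      simp only [hσ]; rw [div_le_div_iff₀ (by norm_num) (by positivity)]; linarith
    have hb : ∀ r ∈ uIoc (σ R) 1, ‖m r‖ ≤ 4 := by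
      intro r hr
      rw [uIoc_of_le (hσ1 R hR0)] at hr
      have hr0 : 0 < r := (hσpos hR0).trans hr.1
      obtain ⟨h1, h2⟩ := hm0 r ⟨hr0, hr.2⟩
      rw [Real.norm_of_nonneg h1]
      calc m r ≤ r ^ (-(2 * s)) := h2
        _ ≤ (1 / 2) ^ (-(2 * s)) := by
          apply Real.rpow_le_rpow_of_nonpos (by positivity) (hσe.trans hr.1.le); linarith
        _ = 2 ^ (2 * s) := by
          rw [Real.div_rpow (by norm_num) (by norm_num), Real.rpow_neg (by norm_num : (0:ℝ) ≤ 2)]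
          simp
        _ ≤ 2 ^ (2 : ℝ) := by gcongr <;> linarith
        _ = _ := by norm_num
    have := intervalIntegral.norm_integral_le_of_norm_le_const hb
    refine this.trans ?_
    rw [abs_of_nonneg (by linarith [hσ1 R hR0])]
    have : 1 - σ R = (1 + R)⁻¹ := by simp only [hσ]; field_simp; ring
    rw [this]
    gcongr
    linarith
  have hmi : Tendsto (fun R : ℝ => ∫ r in (1 : ℝ)..R, m r) atTop (𝓝 (1 / (2 * s))) := by
    have h1 : ∀ R : ℝ, 1 ≤ R → ∫ r in (1 : ℝ)..R, m r = (1 - R ^ (-(2 * s))) / (2 * s) := by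
      intro R hR
      have : ∫ r in (1 : ℝ)..R, m r = ∫ r in (1 : ℝ)..R, r ^ (-1 - 2 * s) := by
        refine intervalIntegral.integral_congr fun r hr => ?_
        rw [uIcc_of_le hR] at hr
        simp only [hm]
        rw [max_eq_right (by linarith [hr.1]), Real.zero_rpow hs0.ne']
        ring
      rw [this, integral_rpow (Or.inr ⟨by linarith, fun h => by
        rw [uIcc_of_le hR] at h; linarith [h.1]⟩)]
      rw [Real.one_rpow, show -1 - 2 * s + 1 = -(2 * s) by ring]
      field_simp
      ring
    have h2 : Tendsto (fun R : ℝ => (1 - R ^ (-(2 * s))) / (2 * s)) atTop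
        (𝓝 ((1 - 0) / (2 * s))) :=
      ((tendsto_rpow_neg_atTop (by linarith : 0 < 2 * s)).const_sub 1).div_const _
    rw [sub_zero] at h2
    refine h2.congr' ?_
    filter_upwards [eventually_ge_atTop 1] with R hR
    exact (h1 R hR).symm
  have hlim2 : Tendsto (fun R : ℝ => ∫ r in R⁻¹..R, powDiff s r * r ^ (-1 - 2 * s)) atTop
      (𝓝 (-(1 / (2 * s)) - 0 + ((0 + 1 / (2 * s)) - 0))) := by
    refine ((hG1.sub hG0).add ((hmR.add hmi).sub hme)).congr' ?_
    filter_upwards [eventually_ge_atTop 1] with R hR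
    have hR0 : 0 < R := by linarith
    have him : ∀ {x y : ℝ}, 0 < x → 0 < y → IntervalIntegrable m volume x y := fun hx hy =>
      (hcm.mono (hpos hx hy)).intervalIntegrable
    rw [key R⁻¹ R (by positivity) hR0, intervalIntegral.integral_add_adjacent_intervals
      (him (hσpos hR0) one_pos) (him one_pos hR0)]
  have := tendsto_nhds_unique hlim1 hlim2
  rw [this]; ring

end PowDiff

section HalfSpace

variable {n : ℕ} {s : ℝ}

theorem integral_eq_zero_of_radial {E : Type*} [NormedAddCommGroup E] [NormedSpace ℝ E]
    [MeasurableSpace E] [BorelSpace E] [FiniteDimensional ℝ E] [Nontrivial E] (μ : Measure E)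
    [μ.IsAddHaarMeasure] {F : E → ℝ}
    (h : ∀ θ : E, ‖θ‖ = 1 →
      ∫ r in Ioi (0 : ℝ), r ^ (Module.finrank ℝ E - 1) * F (r • θ) = 0) :
    ∫ x, F x ∂μ = 0 := by
  calc ∫ x, F x ∂μ = ∫ x : ({(0)}ᶜ : Set E), F x.1 ∂(μ.comap (↑)) := by
        rw [integral_subtype_comap (measurableSet_singleton _).compl F, restrict_compl_singleton]
    _ = ∫ x, F ((x.2 : ℝ) • (x.1 : E))
          ∂μ.toSphere.prod (.volumeIoiPow (Module.finrank ℝ E - 1)) := by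
        rw [← μ.measurePreserving_homeomorphUnitSphereProd.integral_comp
          (Homeomorph.measurableEmbedding _)]
        refine integral_congr_ae (.of_forall fun x => ?_)
        have hx : ‖(x : E)‖ ≠ 0 := norm_ne_zero_iff.2 x.2
        simp [smul_smul, hx]
    _ = 0 := by
        by_cases hi : Integrable (fun x : sphere (0 : E) 1 × Ioi (0 : ℝ) =>
            F ((x.2 : ℝ) • (x.1 : E)))
            (μ.toSphere.prod (.volumeIoiPow (Module.finrank ℝ E - 1)))
        · rw [integral_prod _ hi]
          refine integral_eq_zero_of_ae (.of_forall fun θ => ?_)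
          simp only [Measure.volumeIoiPow, ENNReal.ofReal]
          rw [integral_withDensity_eq_integral_smul
            (measurable_subtype_coe.pow_const _).real_toNNReal,
            integral_subtype_comap measurableSet_Ioi fun a : ℝ =>
              Real.toNNReal (a ^ (Module.finrank ℝ E - 1)) • F (a • (θ : E)),
            setIntegral_congr_fun measurableSet_Ioi fun x hx => ?_]
          · exact h θ (by simp)
          · rw [NNReal.smul_def, Real.coe_toNNReal _ (pow_nonneg (le_of_lt hx) _), smul_eq_mul]
        · exact integral_undef hi

theorem integral_powDiff_mul (hs0 : 0 < s) (hs1 : s < 1) (a : ℝ) :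
    ∫ r in Ioi (0 : ℝ), powDiff s (a * r) * r ^ (-1 - 2 * s) = 0 := by
  wlog ha : 0 ≤ a generalizing a
  · have := this (-a) (by linarith)
    simpa only [neg_mul, powDiff_neg] using this
  rcases ha.eq_or_lt with rfl | ha
  · simp [powDiff_zero]
  have := integral_comp_mul_left_Ioi (fun r => powDiff s r * r ^ (-1 - 2 * s)) 0 ha
  rw [mul_zero, integral_powDiff_self hs0 hs1, smul_zero] at this
  calc _ = ∫ r in Ioi (0 : ℝ), a ^ (1 + 2 * s) *
          (powDiff s (a * r) * (a * r) ^ (-1 - 2 * s)) := by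
        refine setIntegral_congr_fun measurableSet_Ioi fun r hr => ?_
        have hr0 : (0 : ℝ) < r := hr
        rw [Real.mul_rpow ha.le hr0.le]
        have : a ^ (1 + 2 * s) * a ^ (-1 - 2 * s) = 1 := by
          rw [← Real.rpow_add ha]; ring_nf; simp
        linear_combination (-(powDiff s (a * r) * r ^ (-1 - 2 * s))) * this
    _ = 0 := by rw [integral_const_mul, this, mul_zero]

theorem integrable_powDiff_inner (hn : 1 ≤ n) (hs1 : s < 1) {γ : ℝ} (h0 : 0 < γ)
    (hγ : γ < 2 * s) {e : Euc n} (he : ‖e‖ = 1) {t : ℝ} (ht : 0 < t) :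
    Integrable (fun z : Euc n => powDiff γ (⟪z, e⟫ / t) * fracKer n s z) := by
  have hi := (integrable_min_rpow_ker (n := n) (s := s) hn (a := 2) (b := γ) (by linarith)
    hγ).const_mul (10 * (t ^ (-2 : ℝ) + t ^ (-γ)))
  refine hi.mono' (((measurable_powDiff γ).comp (by fun_prop)).mul
    measurable_fracKer).aestronglyMeasurable (.of_forall fun z => ?_)
  rw [norm_mul, Real.norm_eq_abs, Real.norm_of_nonneg (fracKer_nonneg z), ← mul_assoc]
  refine mul_le_mul_of_nonneg_right ?_ (fracKer_nonneg z)
  refine (abs_powDiff_le h0 (by linarith) _).trans ?_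
  have hle : |⟪z, e⟫ / t| ≤ t⁻¹ * ‖z‖ := by
    rw [abs_div, abs_of_pos ht, div_eq_inv_mul]
    gcongr
    simpa [he] using abs_real_inner_le_norm z e
  have hb : ∀ p : ℝ, 0 < p → |⟪z, e⟫ / t| ^ p ≤ t ^ (-p) * ‖z‖ ^ p := fun p hp => by
    calc _ ≤ (t⁻¹ * ‖z‖) ^ p := by gcongr
      _ = _ := by
        rw [Real.mul_rpow (by positivity) (by positivity), Real.inv_rpow ht.le, Real.rpow_neg ht.le]
  rw [mul_assoc, mul_min_of_nonneg (‖z‖ ^ (2 : ℝ)) (‖z‖ ^ γ) (by positivity : 0 ≤ t ^ (-2 : ℝ) + t ^ (-γ))]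
  gcongr
  · refine (hb 2 (by norm_num)).trans ?_
    gcongr
    linarith [Real.rpow_pos_of_pos ht (-γ)]
  · refine (hb γ h0).trans ?_
    gcongr
    linarith [Real.rpow_pos_of_pos ht (-2)]

theorem integral_powDiff_inner (hn : 1 ≤ n) (hs0 : 0 < s) (hs1 : s < 1) (e : Euc n) (t : ℝ) :
    ∫ z : Euc n, powDiff s (⟪z, e⟫ / t) * fracKer n s z = 0 := by
  have : Nonempty (Fin n) := ⟨⟨0, hn⟩⟩
  have : Nontrivial (Euc n) := inferInstance
  refine integral_eq_zero_of_radial _ fun θ hθ => ?_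
  refine (setIntegral_congr_fun measurableSet_Ioi fun r hr => ?_).trans
    (integral_powDiff_mul hs0 hs1 (⟪θ, e⟫ / t))
  have hr0 : 0 < r := hr
  have : r ^ (-1 - 2 * s) = r ^ (n - 1) * (r ^ ((n : ℝ) + 2 * s))⁻¹ := by
    rw [← Real.rpow_neg hr0.le, ← Real.rpow_natCast, ← Real.rpow_add hr0]
    congr 1
    push_cast [hn]
    ring
  simp only [finrank_euclideanSpace, Fintype.card_fin, fracKer, norm_smul, hθ, mul_one,
    Real.norm_of_nonneg hr0.le, inner_smul_left]
  rw [this, show (starRingEnd ℝ) r * ⟪θ, e⟫ / t = ⟪θ, e⟫ / t * r by simp; ring]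
  ring

theorem powDiff_comparison (hs0 : 0 < s) (x : ℝ) :
    2 / 3 * powDiff (3 * s / 2) x + 1 / 3 * (if 1 ≤ |x| then 1 else 0) ≤ powDiff s x := by
  have key : ∀ y : ℝ, max y 0 ^ s ≤ 2 / 3 * max y 0 ^ (3 * s / 2) + 1 / 3 := fun y => by
    have h0 : 0 ≤ max y 0 ^ (3 * s / 2) := by positivity
    have := rpow_one_add_le_one_add_mul_self (s := max y 0 ^ (3 * s / 2) - 1) (p := 2 / 3)
      (by linarith) (by norm_num) (by norm_num)
    rw [add_sub_cancel, ← Real.rpow_mul (le_max_right _ _),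
      show 3 * s / 2 * (2 / 3) = s by ring] at this
    linarith
  have h1 := key (1 + x)
  have h2 := key (1 - x)
  unfold powDiff
  split_ifs with h
  · rcases le_abs.1 h with h | h
    · have : max (1 - x) 0 = 0 := max_eq_right (by linarith)
      rw [this, Real.zero_rpow (by positivity), Real.zero_rpow (by positivity)]
      linarith
    · have : max (1 + x) 0 = 0 := max_eq_right (by linarith)
      rw [this, Real.zero_rpow (by positivity), Real.zero_rpow (by positivity)]
      linarith
  · linarith

/-- A strict power `x_+^{3s/2}` of the distance to a hyperplane is a strict subsolution. -/
theorem exists_integral_powDiff_le (hn : 1 ≤ n) (hs0 : 0 < s) (hs1 : s < 1) :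
    ∃ c > 0, ∀ e : Euc n, ‖e‖ = 1 → ∀ t > 0,
      ∫ z : Euc n, powDiff (3 * s / 2) (⟪z, e⟫ / t) * fracKer n s z ≤ -(c * t ^ (-(2 * s))) := by
  have hv : 0 < volume.real (ball (0 : Euc n) 1) :=
    ENNReal.toReal_pos (measure_ball_pos _ _ one_pos).ne' measure_ball_lt_top.ne
  refine ⟨1 / 2 * (volume.real (ball (0 : Euc n) 1) * 3 ^ (-((n : ℝ) + 2 * s))), by positivity,
    fun e he t ht => ?_⟩
  have hβ := integrable_powDiff_inner (s := s) hn hs1 (γ := 3 * s / 2) (by positivity)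
    (by linarith) he ht
  have hs := integrable_powDiff_inner (s := s) hn hs1 hs0 (by linarith) he ht
  set I : Euc n → ℝ := fun z => if 1 ≤ |⟪z, e⟫ / t| then 1 else 0 with hI
  have hIm : Measurable I := Measurable.ite
    (measurableSet_le measurable_const (by fun_prop)) measurable_const measurable_const
  have hIi : Integrable (fun z => I z * fracKer n s z) := by
    refine ((hs.norm.add (hβ.norm)).const_mul 3).mono' (hIm.mul
      measurable_fracKer).aestronglyMeasurable (.of_forall fun z => ?_)
    have h1 := powDiff_comparison hs0 (⟪z, e⟫ / t)
    have hk := fracKer_nonneg (n := n) (s := s) z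
    have hI0 : 0 ≤ I z := by simp only [hI]; split_ifs <;> norm_num
    rw [Real.norm_of_nonneg (mul_nonneg hI0 hk)]
    simp only [Pi.add_apply, norm_mul, Real.norm_eq_abs, abs_of_nonneg hk]
    have h2 : I z ≤ 3 * (|powDiff s (⟪z, e⟫ / t)| + |powDiff (3 * s / 2) (⟪z, e⟫ / t)|) := by
      simp only [hI]
      have := le_abs_self (powDiff s (⟪z, e⟫ / t))
      have := neg_abs_le (powDiff (3 * s / 2) (⟪z, e⟫ / t))
      have := abs_nonneg (powDiff (3 * s / 2) (⟪z, e⟫ / t))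
      linarith
    calc _ ≤ _ := mul_le_mul_of_nonneg_right h2 hk
      _ = _ := by ring
  have hlow := le_integral_ker_of_ball hs0 (h := I)
    (fun z => by simp only [hI]; split_ifs <;> norm_num) hIi (a := (2 * t) • e) (r := t)
    (R := 3 * t) (c := 1) ht (fun z hz => by
      have hz' : ‖z - (2 * t) • e‖ < t := by simpa [dist_eq_norm] using hz
      have h1 : |⟪z - (2 * t) • e, e⟫| ≤ ‖z - (2 * t) • e‖ := by
        simpa [he] using abs_real_inner_le_norm (z - (2 * t) • e) e
      have h2 : ⟪z, e⟫ = ⟪z - (2 * t) • e, e⟫ + 2 * t := by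
        rw [inner_sub_left, inner_smul_left, real_inner_self_eq_norm_sq, he]; simp
      have h3 : t ≤ ⟪z, e⟫ := by linarith [neg_abs_le ⟪z - (2 * t) • e, e⟫]
      have h4 : ⟪z, e⟫ ≤ ‖z‖ := by simpa [he] using real_inner_le_norm z e
      have h5 : ‖z‖ ≤ ‖z - (2 * t) • e‖ + ‖(2 * t) • e‖ := by
        simpa using norm_add_le (z - (2 * t) • e) ((2 * t) • e)
      rw [norm_smul, he, Real.norm_of_nonneg (by positivity)] at h5
      refine ⟨?_, by linarith, by linarith⟩
      have : 1 ≤ |⟪z, e⟫ / t| := by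
        rw [abs_div, abs_of_pos ht, le_div_iff₀ ht, one_mul]
        exact h3.trans (le_abs_self _)
      simp [hI, this])
  have hint : 2 / 3 * (∫ z : Euc n, powDiff (3 * s / 2) (⟪z, e⟫ / t) * fracKer n s z)
      + 1 / 3 * ∫ z, I z * fracKer n s z ≤ 0 := by
    rw [← integral_powDiff_inner hn hs0 hs1 e t, ← integral_const_mul, ← integral_const_mul,
      ← integral_add (hβ.const_mul _) (hIi.const_mul _)]
    refine integral_mono ((hβ.const_mul _).add (hIi.const_mul _)) hs fun z => ?_
    have := mul_le_mul_of_nonneg_right (powDiff_comparison hs0 (⟪z, e⟫ / t))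
      (fracKer_nonneg (n := n) (s := s) z)
    simp only [hI]
    linarith
  have hpow : t ^ n * (3 * t) ^ (-((n : ℝ) + 2 * s)) =
      3 ^ (-((n : ℝ) + 2 * s)) * t ^ (-(2 * s)) := by
    rw [Real.mul_rpow (by norm_num) ht.le, ← Real.rpow_natCast t n, mul_left_comm,
      ← Real.rpow_add ht]
    congr 2; ring
  rw [mul_assoc, hpow] at hlow
  nlinarith

end HalfSpace

/-- Radial profile of the barrier. -/
def barrierProfile (s r : ℝ) : ℝ := min r 1 ^ s - 1 / 2 * min r 1 ^ (3 * s / 2)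

/-- Barrier vanishing on the ball of centre `c` and radius `ρ`. -/
def barrier {n : ℕ} (s : ℝ) (c : Euc n) (ρ : ℝ) (y : Euc n) : ℝ :=
  barrierProfile s (max (‖y - c‖ - ρ) 0)

section Barrier

variable {n : ℕ} {s : ℝ}

theorem rpow_three_halves_le {r : ℝ} (hs0 : 0 < s) (h0 : 0 ≤ r) (h1 : r ≤ 1) :
    r ^ (3 * s / 2) ≤ r ^ s :=
  Real.rpow_le_rpow_of_exponent_ge_of_imp h0 h1 (by linarith) (fun _ h => by linarith)

theorem barrierProfile_nonneg (hs0 : 0 < s) {r : ℝ} (hr : 0 ≤ r) : 0 ≤ barrierProfile s r := by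
  have h0 : 0 ≤ min r 1 := le_min hr zero_le_one
  have := rpow_three_halves_le hs0 h0 (min_le_right r 1)
  have : 0 ≤ min r 1 ^ s := by positivity
  unfold barrierProfile
  linarith

theorem barrierProfile_le_half (hs0 : 0 < s) {r : ℝ} (hr : 0 ≤ r) : barrierProfile s r ≤ 1 / 2 := by
  have h0 : 0 ≤ min r 1 := le_min hr zero_le_one
  have h1 := rpow_one_add_le_one_add_mul_self (s := min r 1 ^ (3 * s / 2) - 1) (p := 2 / 3)
    (by linarith [Real.rpow_nonneg h0 (3 * s / 2)]) (by norm_num) (by norm_num)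
  rw [add_sub_cancel, ← Real.rpow_mul h0, show 3 * s / 2 * (2 / 3) = s by ring] at h1
  have h2 : min r 1 ^ (3 * s / 2) ≤ 1 := Real.rpow_le_one h0 (min_le_right _ _) (by positivity)
  unfold barrierProfile
  linarith

theorem barrierProfile_le_rpow (hs0 : 0 < s) {r : ℝ} (hr : 0 ≤ r) : barrierProfile s r ≤ r ^ s := by
  have h0 : 0 ≤ min r 1 := le_min hr zero_le_one
  have h1 : min r 1 ^ s ≤ r ^ s := by gcongr; exact min_le_left _ _
  have : 0 ≤ min r 1 ^ (3 * s / 2) := by positivity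
  unfold barrierProfile
  linarith

theorem half_rpow_le_barrierProfile (hs0 : 0 < s) {r a : ℝ} (ha : 0 ≤ a) (ha1 : a ≤ 1)
    (har : a ≤ r) : 1 / 2 * a ^ s ≤ barrierProfile s r := by
  have h0 : 0 ≤ min r 1 := le_min (ha.trans har) zero_le_one
  have h1 : a ^ s ≤ min r 1 ^ s := by gcongr; exact le_min har ha1
  have := rpow_three_halves_le hs0 h0 (min_le_right r 1)
  unfold barrierProfile
  linarith

theorem continuous_barrierProfile (hs0 : 0 < s) : Continuous (barrierProfile s) := by
  unfold barrierProfile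
  refine Continuous.sub ?_ (Continuous.mul continuous_const ?_)
  · exact (continuous_id.min continuous_const).rpow_const fun _ => Or.inr hs0.le
  · exact (continuous_id.min continuous_const).rpow_const fun _ => Or.inr (by positivity)

theorem continuous_barrier (hs0 : 0 < s) (c : Euc n) (ρ : ℝ) : Continuous (barrier s c ρ) :=
  (continuous_barrierProfile hs0).comp (by fun_prop)

theorem barrier_nonneg (hs0 : 0 < s) (c : Euc n) (ρ : ℝ) (y : Euc n) : 0 ≤ barrier s c ρ y :=
  barrierProfile_nonneg hs0 (le_max_right _ _)

theorem norm_add_sub_le {e z : Euc n} (he : ‖e‖ = 1) {ρ t : ℝ} (hρ : 0 < ρ) (ht : 0 < t) :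
    ‖(ρ + t) • e + z‖ - ρ ≤ t + ⟪z, e⟫ + ‖z‖ ^ 2 / (2 * ρ) := by
  set a := ρ + t
  have ha : 0 < a := by positivity
  have h1 : ‖a • e + z‖ ^ 2 = a ^ 2 + 2 * a * ⟪z, e⟫ + ‖z‖ ^ 2 := by
    rw [norm_add_sq_real, norm_smul, he, inner_smul_left, real_inner_comm, Real.norm_of_nonneg ha.le]
    simp; ring
  have h2 : ‖a • e + z‖ ≤ a + ⟪z, e⟫ + ‖z‖ ^ 2 / (2 * a) := by
    have : a + ⟪z, e⟫ + ‖z‖ ^ 2 / (2 * a) = (‖a • e + z‖ ^ 2 + a ^ 2) / (2 * a) := by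
      rw [h1]; field_simp; ring
    rw [this, le_div_iff₀ (by positivity)]
    nlinarith [sq_nonneg (‖a • e + z‖ - a)]
  have h3 : ‖z‖ ^ 2 / (2 * a) ≤ ‖z‖ ^ 2 / (2 * ρ) := by
    gcongr; simp only [a]; linarith
  simp only [a] at *
  linarith

theorem le_norm_add_sub {e z : Euc n} (he : ‖e‖ = 1) (ρ t : ℝ) :
    t + ⟪z, e⟫ ≤ ‖(ρ + t) • e + z‖ - ρ := by
  have h := real_inner_le_norm ((ρ + t) • e + z) e
  rw [inner_add_left, inner_smul_left, real_inner_self_eq_norm_sq, he] at h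
  simp at h
  linarith

/-- Replacing the distance to a ball by the distance to the tangent half-space costs an
integrable error. -/
theorem barrierProfile_le_halfSpace (hs0 : 0 < s) (hs1 : s < 1) {ρ t η : ℝ} (hρ : 0 < ρ)
    (ht : 0 < t) (ht2 : t < 1 / 2) (hη0 : 0 < η) (hη1 : η ≤ 1 - s) {e : Euc n}
    (he : ‖e‖ = 1) (z : Euc n) :
    barrierProfile s (max (‖(ρ + t) • e + z‖ - ρ) 0) ≤
      max (t + ⟪z, e⟫) 0 ^ s - 1 / 2 * max (t + ⟪z, e⟫) 0 ^ (3 * s / 2) +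
      (1 / ρ + 2 * (2 * ρ) ^ (-s) + 4) * t ^ (-η) *
        min (‖z‖ ^ (2 * s + η)) (‖z‖ ^ (3 * s / 2)) := by
  set D := max (‖(ρ + t) • e + z‖ - ρ) 0 with hD
  set h := max (t + ⟪z, e⟫) 0 with hh
  set q := ‖z‖ ^ 2 / (2 * ρ) with hq
  have hq0 : 0 ≤ q := by positivity
  have hh0 : 0 ≤ h := le_max_right _ _
  have hD0 : 0 ≤ D := le_max_right _ _
  have hhD : h ≤ D := max_le_max (le_norm_add_sub he ρ t) le_rfl
  have hDq : D ≤ h + q := max_le ((norm_add_sub_le he hρ ht).trans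
    (by gcongr; exact le_max_left _ _)) (by positivity)
  have hin : |⟪z, e⟫| ≤ ‖z‖ := by simpa [he] using abs_real_inner_le_norm z e
  have hz0 := norm_nonneg z
  have hC1 : 0 ≤ 1 / ρ := by positivity
  have hC2 : 0 ≤ (2 * ρ) ^ (-s) := by positivity
  have htη : 1 ≤ t ^ (-η) := Real.one_le_rpow_of_pos_of_le_one_of_nonpos ht (by linarith)
    (by linarith)
  rcases lt_or_ge ‖z‖ (1 / 2) with hz | hz
  · have hD1 : D ≤ 1 := by
      refine max_le ?_ zero_le_one
      have : ‖(ρ + t) • e + z‖ ≤ (ρ + t) + ‖z‖ := by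
        refine (norm_add_le _ _).trans_eq ?_
        rw [norm_smul, he, Real.norm_of_nonneg (by positivity), mul_one]
      linarith
    have hmin : min (‖z‖ ^ (2 * s + η)) (‖z‖ ^ (3 * s / 2)) = ‖z‖ ^ (2 * s + η) :=
      min_eq_left (Real.rpow_le_rpow_of_exponent_ge_of_imp hz0 (by linarith) (by linarith)
        (fun _ h => by linarith))
    have hφ : barrierProfile s D ≤ (h + q) ^ s - 1 / 2 * h ^ (3 * s / 2) := by
      unfold barrierProfile
      rw [min_eq_left hD1]
      have : D ^ s ≤ (h + q) ^ s := by gcongr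
      have : h ^ (3 * s / 2) ≤ D ^ (3 * s / 2) := by gcongr
      linarith
    rw [hmin]
    suffices hsuff : (h + q) ^ s ≤ h ^ s +
        (1 / ρ + 2 * (2 * ρ) ^ (-s)) * (t ^ (-η) * ‖z‖ ^ (2 * s + η)) by
      have : 0 ≤ t ^ (-η) * ‖z‖ ^ (2 * s + η) := by positivity
      nlinarith
    have hW : 0 ≤ t ^ (-η) * ‖z‖ ^ (2 * s + η) := by positivity
    rcases lt_or_ge ‖z‖ (t / 2) with hzt | hzt
    · have hht : t / 2 ≤ h := le_trans (by linarith [neg_abs_le ⟪z, e⟫]) (le_max_left _ _)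
      have hhp : 0 < h := by linarith
      have hb := rpow_one_add_le_one_add_mul_self (s := q / h) (p := s)
        (by have : 0 ≤ q / h := by positivity
            linarith) hs0.le hs1.le
      have h1 : (h + q) ^ s ≤ h ^ s + s * h ^ (s - 1) * q := by
        calc (h + q) ^ s = h ^ s * (1 + q / h) ^ s := by
              rw [← Real.mul_rpow hh0 (by positivity)]; congr 1; field_simp
          _ ≤ h ^ s * (1 + s * (q / h)) := by gcongr
          _ = _ := by rw [Real.rpow_sub hhp, Real.rpow_one]; field_simp
      have h2 : h ^ (s - 1) ≤ 2 * t ^ (s - 1) := by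
        calc h ^ (s - 1) ≤ (t / 2) ^ (s - 1) :=
              Real.rpow_le_rpow_of_nonpos (by positivity) hht (by linarith)
          _ = 2 ^ (1 - s) * t ^ (s - 1) := by
              rw [Real.div_rpow ht.le (by norm_num), div_eq_mul_inv, ← Real.rpow_neg (by norm_num),
                neg_sub, mul_comm]
          _ ≤ 2 ^ (1 : ℝ) * t ^ (s - 1) := by
              gcongr
              · norm_num
              · linarith
          _ = _ := by norm_num
      have h3 : t ^ (s - 1) * ‖z‖ ^ 2 ≤ t ^ (-η) * ‖z‖ ^ (2 * s + η) := by
        have e1 : ‖z‖ ^ 2 = ‖z‖ ^ (2 * s + η) * ‖z‖ ^ (2 - 2 * s - η) := by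
          rw [← Real.rpow_add_of_nonneg hz0 (by positivity) (by linarith), ← Real.rpow_natCast]
          congr 1; push_cast; ring
        have e2 : ‖z‖ ^ (2 - 2 * s - η) ≤ t ^ (2 - 2 * s - η) :=
          Real.rpow_le_rpow hz0 (by linarith) (by linarith)
        have e3 : t ^ (s - 1) * t ^ (2 - 2 * s - η) ≤ t ^ (-η) := by
          rw [← Real.rpow_add ht]
          exact Real.rpow_le_rpow_of_exponent_ge ht (by linarith) (by linarith)
        calc _ = ‖z‖ ^ (2 * s + η) * (t ^ (s - 1) * ‖z‖ ^ (2 - 2 * s - η)) := by rw [e1]; ring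
          _ ≤ ‖z‖ ^ (2 * s + η) * (t ^ (s - 1) * t ^ (2 - 2 * s - η)) := by gcongr
          _ ≤ ‖z‖ ^ (2 * s + η) * t ^ (-η) := by gcongr
          _ = _ := mul_comm _ _
      calc (h + q) ^ s ≤ h ^ s + s * h ^ (s - 1) * q := h1
        _ ≤ h ^ s + 1 * (2 * t ^ (s - 1)) * q := by gcongr
        _ = h ^ s + 1 / ρ * (t ^ (s - 1) * ‖z‖ ^ 2) := by rw [hq]; field_simp
        _ ≤ h ^ s + 1 / ρ * (t ^ (-η) * ‖z‖ ^ (2 * s + η)) := by gcongr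
        _ ≤ _ := by gcongr; linarith
    · have h1 : (h + q) ^ s ≤ h ^ s + q ^ s := Real.rpow_add_le_add_rpow hh0 hq0 hs0.le hs1.le
      have h2 : q ^ s = (2 * ρ) ^ (-s) * ‖z‖ ^ (2 * s) := by
        rw [hq, Real.div_rpow (by positivity) (by positivity), Real.rpow_neg (by positivity),
          ← Real.rpow_natCast, ← Real.rpow_mul hz0]
        push_cast
        rw [div_eq_inv_mul]
      have h3 : ‖z‖ ^ (2 * s) ≤ 2 * (t ^ (-η) * ‖z‖ ^ (2 * s + η)) := by
        have hzp : 0 < ‖z‖ := by linarith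
        have : 1 ≤ 2 * t ^ (-η) * ‖z‖ ^ η := by
          have e1 : (t / 2) ^ η ≤ ‖z‖ ^ η := by gcongr
          have e2 : (t / 2) ^ η * t ^ (-η) = 2 ^ (-η) := by
            rw [Real.div_rpow ht.le (by norm_num), Real.rpow_neg ht.le, Real.rpow_neg (by norm_num)]
            field_simp
          have e3 : (2 : ℝ) ^ (-1 : ℝ) ≤ 2 ^ (-η) := by
            gcongr
            · norm_num
            · linarith
          have e4 : (2 : ℝ) ^ (-1 : ℝ) = 1 / 2 := by rw [Real.rpow_neg_one]; norm_num
          have : (t / 2) ^ η * t ^ (-η) ≤ ‖z‖ ^ η * t ^ (-η) := by gcongr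
          rw [e2] at this
          rw [e4] at e3
          linarith
        rw [Real.rpow_add hzp]
        have h0 : 0 ≤ ‖z‖ ^ (2 * s) := by positivity
        nlinarith
      calc (h + q) ^ s ≤ h ^ s + (2 * ρ) ^ (-s) * ‖z‖ ^ (2 * s) := h2 ▸ h1
        _ ≤ h ^ s + (2 * ρ) ^ (-s) * (2 * (t ^ (-η) * ‖z‖ ^ (2 * s + η))) := by gcongr
        _ ≤ _ := by nlinarith
  · have hφ := barrierProfile_le_half hs0 hD0
    have hzp : 0 < ‖z‖ := by linarith
    have h1 : h ^ (3 * s / 2) ≤ (2 * ‖z‖) ^ (3 * s / 2) := by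
      gcongr
      exact max_le (by linarith [le_abs_self ⟪z, e⟫]) (by positivity)
    have h2 : 1 ≤ (2 * ‖z‖) ^ (3 * s / 2) := Real.one_le_rpow (by linarith) (by positivity)
    have h3 : (2 * ‖z‖) ^ (3 * s / 2) ≤ (2 * ‖z‖) ^ (2 * s + η) :=
      Real.rpow_le_rpow_of_exponent_le (by linarith) (by linarith)
    have hp : ∀ p : ℝ, p ≤ 2 → (2 * ‖z‖) ^ p ≤ 4 * ‖z‖ ^ p := fun p hp => by
      rw [Real.mul_rpow (by norm_num) hz0]
      gcongr
      calc (2 : ℝ) ^ p ≤ 2 ^ (2 : ℝ) := by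
            gcongr
            norm_num
        _ = 4 := by norm_num
    have h4 := hp (3 * s / 2) (by linarith)
    have h5 := hp (2 * s + η) (by linarith)
    have h6 : (2 * ‖z‖) ^ (3 * s / 2) ≤ 4 * min (‖z‖ ^ (2 * s + η)) (‖z‖ ^ (3 * s / 2)) := by
      rw [mul_min_of_nonneg _ _ (by norm_num : (0 : ℝ) ≤ 4)]
      exact le_min (h3.trans h5) h4
    have h7 : 0 ≤ min (‖z‖ ^ (2 * s + η)) (‖z‖ ^ (3 * s / 2)) := by positivity
    have h8 : 4 * min (‖z‖ ^ (2 * s + η)) (‖z‖ ^ (3 * s / 2)) ≤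
        (1 / ρ + 2 * (2 * ρ) ^ (-s) + 4) * t ^ (-η) *
          min (‖z‖ ^ (2 * s + η)) (‖z‖ ^ (3 * s / 2)) := by
      gcongr
      nlinarith
    have h9 : 0 ≤ h ^ s := by positivity
    linarith only [h8, h6, h1, h2, h9, hφ]

theorem rpow_mul_powDiff {t γ τ : ℝ} (ht : 0 < t) :
    t ^ γ * powDiff γ (τ / t) = 2 * t ^ γ - max (t + τ) 0 ^ γ - max (t - τ) 0 ^ γ := by
  have h : ∀ x : ℝ, max (t + x) 0 ^ γ = t ^ γ * max (1 + x / t) 0 ^ γ := fun x => by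
    rw [← Real.mul_rpow ht.le (le_max_right _ _), mul_max_of_nonneg _ _ ht.le]
    congr 2
    · field_simp
    · simp
  rw [sub_eq_add_neg t τ, h, h, powDiff, neg_div, ← sub_eq_add_neg]
  ring

theorem integral_sub_sub_mul {f g h k : Euc n → ℝ} (hf : Integrable (fun z => f z * k z))
    (hg : Integrable (fun z => g z * k z)) (hh : Integrable (fun z => h z * k z)) (a b c : ℝ) :
    Integrable (fun z => (a * f z - b * g z - c * h z) * k z) ∧
    ∫ z, (a * f z - b * g z - c * h z) * k z =
      a * (∫ z, f z * k z) - b * (∫ z, g z * k z) - c * ∫ z, h z * k z := by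
  have e : (fun z => (a * f z - b * g z - c * h z) * k z) =
      fun z => a * (f z * k z) - b * (g z * k z) - c * (h z * k z) := by ext z; ring
  have h1 : Integrable (fun z => a * (f z * k z) - b * (g z * k z)) :=
    (hf.const_mul a).sub (hg.const_mul b)
  rw [e]
  refine ⟨h1.sub (hh.const_mul c), ?_⟩
  rw [integral_sub h1 (hh.const_mul c), integral_sub (hf.const_mul a) (hg.const_mul b),
    integral_const_mul, integral_const_mul, integral_const_mul]

theorem le_quadratic_of_large {c K A y : ℝ} (hc : 0 < c) (hK : 0 ≤ K)
    (hy : 1 + 4 / c * (K + |A|) ≤ y) : A ≤ 1 / 4 * (c * y ^ 2) - K * y := by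
  have hA := abs_nonneg A
  have h0 : 0 ≤ 4 / c * (K + |A|) := by positivity
  have h1 : K + |A| ≤ c / 4 * y := by
    calc _ = c / 4 * (4 / c * (K + |A|)) := by field_simp
      _ ≤ _ := by gcongr; linarith
  have h2 : |A| ≤ |A| * y := le_mul_of_one_le_right hA (by linarith)
  have h3 : y * (K + |A|) ≤ y * (c / 4 * y) := mul_le_mul_of_nonneg_left h1 (by linarith)
  linarith [le_abs_self A]

/-- Near the ball on which it vanishes, the barrier is a strict supersolution. -/
theorem exists_barrier_minorant (hn : 1 ≤ n) (hs0 : 0 < s) (hs1 : s < 1) {ρ : ℝ} (hρ : 0 < ρ)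
    (A : ℝ) :
    ∃ r₀ > 0, r₀ ≤ 1 / 2 ∧ r₀ ≤ ρ ∧ ∀ c x : Euc n, ρ < ‖x - c‖ → ‖x - c‖ < ρ + r₀ →
      ∃ h : Euc n → ℝ, Integrable (fun z => h z * fracKer n s z) ∧
        (∀ z, 2 * h z ≤
          2 * barrier s c ρ x - barrier s c ρ (x + z) - barrier s c ρ (x + -z)) ∧
        A ≤ ∫ z, h z * fracKer n s z := by
  obtain ⟨c₁, hc₁, hβ⟩ := exists_integral_powDiff_le hn hs0 hs1
  set η := min (s / 4) (1 - s) with hη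
  have hη0 : 0 < η := lt_min (by positivity) (by linarith)
  have hη1 : η ≤ 1 - s := min_le_right _ _
  have hηs : η ≤ s / 4 := min_le_left _ _
  set CE := 1 / ρ + 2 * (2 * ρ) ^ (-s) + 4 with hCE
  have hCE0 : 0 < CE := by positivity
  set E : Euc n → ℝ := fun z => min (‖z‖ ^ (2 * s + η)) (‖z‖ ^ (3 * s / 2)) with hE
  have hEi : Integrable (fun z => E z * fracKer n s z) :=
    integrable_min_rpow_ker hn (by linarith) (by linarith)
  set m := ∫ z, E z * fracKer n s z with hm
  have hm0 : 0 ≤ m := integral_nonneg fun z =>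
    mul_nonneg (by simp only [hE]; positivity) (fracKer_nonneg z)
  set y₀ := 1 + 4 / c₁ * (CE * m + |A|)
  have hy₀1 : 1 ≤ y₀ := by
    have : 0 ≤ 4 / c₁ * (CE * m + |A|) := by positivity
    linarith
  refine ⟨min (min (1 / 2) ρ) (y₀ ^ (-(4 / s))), lt_min (lt_min (by norm_num) hρ) (by positivity),
    (min_le_left _ _).trans (min_le_left _ _), (min_le_left _ _).trans (min_le_right _ _),
    fun c x hx1 hx2 => ?_⟩
  set t := ‖x - c‖ - ρ with ht
  have ht0 : 0 < t := by linarith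
  have htlt : t < min (min (1 / 2) ρ) (y₀ ^ (-(4 / s))) := by linarith
  have ht2 : t < 1 / 2 := htlt.trans_le ((min_le_left _ _).trans (min_le_left _ _))
  have hty : t < y₀ ^ (-(4 / s)) := htlt.trans_le (min_le_right _ _)
  have hxc : 0 < ‖x - c‖ := by linarith
  set e := ‖x - c‖⁻¹ • (x - c) with hee
  have he : ‖e‖ = 1 := by
    rw [hee, norm_smul, norm_inv, norm_norm, inv_mul_cancel₀ hxc.ne']
  have hxe : ∀ z, x + z - c = (ρ + t) • e + z := fun z => by
    rw [hee, show ρ + t = ‖x - c‖ by simp [ht], smul_smul, mul_inv_cancel₀ hxc.ne', one_smul]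
    abel
  have hbx : barrier s c ρ x = t ^ s - 1 / 2 * t ^ (3 * s / 2) := by
    unfold barrier barrierProfile
    rw [max_eq_left (by linarith), min_eq_left (by linarith)]
  set Ss : Euc n → ℝ := fun z => powDiff s (⟪z, e⟫ / t)
  set Sβ : Euc n → ℝ := fun z => powDiff (3 * s / 2) (⟪z, e⟫ / t)
  have hSs := integrable_powDiff_inner (s := s) hn hs1 hs0 (by linarith) he ht0
  have hSβ := integrable_powDiff_inner (s := s) hn hs1 (γ := 3 * s / 2) (by positivity)
    (by linarith) he ht0
  have hI := integral_sub_sub_mul hSs hSβ hEi (1 / 2 * t ^ s) (1 / 4 * t ^ (3 * s / 2))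
    (CE * t ^ (-η))
  refine ⟨fun z => 1 / 2 * t ^ s * Ss z - 1 / 4 * t ^ (3 * s / 2) * Sβ z
    - CE * t ^ (-η) * E z, hI.1, fun z => ?_, ?_⟩
  · have h1 := barrierProfile_le_halfSpace hs0 hs1 hρ ht0 ht2 hη0 hη1 he z
    have h2 := barrierProfile_le_halfSpace hs0 hs1 hρ ht0 ht2 hη0 hη1 he (-z)
    rw [norm_neg, inner_neg_left, ← sub_eq_add_neg t] at h2
    have h3 := rpow_mul_powDiff (γ := s) (τ := ⟪z, e⟫) ht0
    have h4 := rpow_mul_powDiff (γ := 3 * s / 2) (τ := ⟪z, e⟫) ht0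
    rw [hbx]
    unfold barrier
    rw [hxe, hxe]
    simp only [Ss, Sβ, hE]
    linarith only [h1, h2, h3, h4]
  · rw [hI.2, integral_powDiff_inner hn hs0 hs1 e t, mul_zero, zero_sub]
    have h1 := hβ e he t ht0
    set y := t ^ (-(s / 4)) with hy
    have hyy : y₀ ≤ y := by
      calc y₀ = (y₀ ^ (-(4 / s))) ^ (-(s / 4)) := by
            rw [← Real.rpow_mul (by linarith)]
            have : -(4 / s) * -(s / 4) = 1 := by field_simp
            rw [this, Real.rpow_one]
        _ ≤ _ := Real.rpow_le_rpow_of_nonpos ht0 hty.le (by linarith)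
    have h2 : t ^ (3 * s / 2) * t ^ (-(2 * s)) = y ^ 2 := by
      rw [← Real.rpow_add ht0, hy, ← Real.rpow_natCast, ← Real.rpow_mul ht0.le]
      congr 1; push_cast; ring
    have h3 : t ^ (-η) ≤ y :=
      Real.rpow_le_rpow_of_exponent_ge ht0 (by linarith) (by linarith)
    have h4 : t ^ (3 * s / 2) * (∫ z, Sβ z * fracKer n s z) ≤ -(c₁ * y ^ 2) := by
      refine (mul_le_mul_of_nonneg_left h1 (Real.rpow_nonneg ht0.le _)).trans_eq ?_
      rw [← h2]; ring
    have h5 := mul_le_mul_of_nonneg_left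
      (mul_le_mul_of_nonneg_right h3 hm0) hCE0.le
    have h6 := le_quadratic_of_large hc₁ (mul_nonneg hCE0.le hm0) hyy
    linarith only [h4, h5, h6]

end Barrier

/-- The principal value `∫ (u(x) - u(x+z)) |z|^{-n-2s} dz` exists and equals `v`. -/
def HasPVAt (n : ℕ) (s : ℝ) (u : Euc n → ℝ) (x : Euc n) (v : ℝ) : Prop :=
  Tendsto (fun ε : ℝ => ∫ z in {z : Euc n | ε ≤ ‖z‖}, (u x - u (x + z)) * fracKer n s z)
    (𝓝[>] 0) (𝓝 v)

section BoundaryDecay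

variable {n : ℕ} {s : ℝ}

theorem aestronglyMeasurable_comp_add {u : Euc n → ℝ} (hu : AEStronglyMeasurable u volume)
    (x : Euc n) : AEStronglyMeasurable (fun z => u (x + z)) volume :=
  hu.comp_quasiMeasurePreserving (measurePreserving_add_left volume x).quasiMeasurePreserving

theorem HasPVAt.integral_le (hn : 1 ≤ n) (hs0 : 0 < s) (hs1 : s < 1) {u h : Euc n → ℝ}
    {x : Euc n} {v : ℝ} (hpv : HasPVAt n s u x v) (hum : AEStronglyMeasurable u volume)
    (hu : ∀ y, 0 ≤ u y ∧ u y ≤ 1) (hi : Integrable (fun z => h z * fracKer n s z))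
    (hle : ∀ z, 2 * h z ≤ 2 * u x - u (x + z) - u (x + -z)) :
    ∫ z, h z * fracKer n s z ≤ v := by
  refine integral_le_of_tendsto_trunc (f := fun z => u x - u (x + z)) hs0 (fun ε hε => ?_) hpv hi
    fun z => (hle z).trans_eq (by ring)
  refine integrableOn_bdd_ker hn hs0 hs1 (C := 1)
    (aestronglyMeasurable_const.sub (aestronglyMeasurable_comp_add hum x)) (fun z => ?_) hε
  simp only [Pi.sub_apply]
  rw [abs_le]
  constructor <;> linarith [(hu x).1, (hu x).2, (hu (x + z)).1, (hu (x + z)).2]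

theorem exists_nearest_boundary {Ω : Set (Euc n)} (hΩ : IsOpen Ω) {x : Euc n} (hx : x ∈ Ω)
    (hne : (Ωᶜ).Nonempty) :
    ∃ p ∈ frontier Ω, 0 < ‖x - p‖ ∧ ∀ y ∉ Ω, ‖x - p‖ ≤ ‖x - y‖ := by
  obtain ⟨p, hp, hd⟩ := hΩ.isClosed_compl.exists_infDist_eq_dist hne x
  have hmin : ∀ y ∉ Ω, ‖x - p‖ ≤ ‖x - y‖ := fun y hy => by
    rw [← dist_eq_norm, ← dist_eq_norm, ← hd]
    exact infDist_le_dist_of_mem hy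
  have hpos : 0 < ‖x - p‖ := norm_sub_pos_iff.2 fun h => hp (h ▸ hx)
  refine ⟨p, ⟨?_, fun h => hp (interior_subset h)⟩, hpos, hmin⟩
  have hb : ball x ‖x - p‖ ⊆ Ω := fun y hy => by
    by_contra h
    have := hmin y h
    rw [mem_ball, dist_comm, dist_eq_norm] at hy
    linarith
  refine closure_mono hb ?_
  rw [closure_ball _ hpos.ne', mem_closedBall, dist_comm, dist_eq_norm]

/-- The tangent balls of radius `r` are contained in those of radius `ρ ≥ r`. -/
theorem TwoSidedBallAt.mono {Ω : Set (Euc n)} {ρ r : ℝ} {z : Euc n}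
    (h : TwoSidedBallAt n Ω ρ z) (hr : r ≤ ρ) : TwoSidedBallAt n Ω r z := by
  obtain ⟨ν, hν, h1, h2⟩ := h
  have hn : ‖(ρ - r) • ν‖ = ρ - r := by
    rw [norm_smul, hν, Real.norm_of_nonneg (by linarith), mul_one]
  refine ⟨ν, hν, (ball_subset_ball' ?_).trans h1, (ball_subset_ball' ?_).trans h2⟩
  · rw [dist_comm, dist_eq_norm, add_sub_add_left_eq_sub, ← sub_smul, hn]; linarith
  · rw [dist_eq_norm, sub_sub_sub_cancel_left, ← sub_smul, hn]; linarith

/-- Data of the normalized boundary value problem near `x₀`. -/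
structure BoundaryProblem (n : ℕ) (s A : ℝ) (Ω : Set (Euc n)) (x₀ : Euc n) (ρ : ℝ)
    (u : Euc n → ℝ) : Prop where
  isOpen : IsOpen Ω
  base : x₀ ∉ Ω
  twoSided : ∀ z ∈ frontier Ω ∩ ball x₀ 2, TwoSidedBallAt n Ω ρ z
  meas : AEStronglyMeasurable u volume
  bound : ∀ y, 0 ≤ u y ∧ u y ≤ 1
  cont : ContinuousOn u (Ω ∩ ball x₀ 2)
  zero : ∀ x ∈ ball x₀ 2 \ Ω, u x = 0
  pv : ∀ x ∈ Ω ∩ ball x₀ 2, ∃ v, |v| ≤ A ∧ HasPVAt n s u x v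

/-- Integral lower bound at an approximate maximum which sees a ball at comparable distance. -/
theorem exists_eta_minorant (hn : 1 ≤ n) (hs0 : 0 < s) (hs1 : s < 1) :
    ∃ η > 0, η ≤ 1 / 2 ∧ ∀ (r m : ℝ) (b : Euc n), 0 < r → 0 < m →
      (∀ z ∈ ball b r, r ≤ ‖z‖ ∧ ‖z‖ ≤ 5 * r) →
      Integrable (fun z => (1 / 4 * m * (ball b r).indicator 1 z
        - η * m * min (‖z‖ ^ 2 / r ^ 2) 1) * fracKer n s z) ∧
      0 ≤ ∫ z, (1 / 4 * m * (ball b r).indicator 1 z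
        - η * m * min (‖z‖ ^ 2 / r ^ 2) 1) * fracKer n s z := by
  have hv : 0 < volume.real (ball (0 : Euc n) 1) :=
    ENNReal.toReal_pos (measure_ball_pos _ _ one_pos).ne' measure_ball_lt_top.ne
  set κ := 1 / 4 * (volume.real (ball (0 : Euc n) 1) * 5 ^ (-((n : ℝ) + 2 * s))) with hκ
  have hκ0 : 0 < κ := by positivity
  set m₀ := ∫ z : Euc n, min (‖z‖ ^ 2) 1 * fracKer n s z with hm₀
  have hm₀0 : 0 ≤ m₀ := integral_nonneg fun z => mul_nonneg (by positivity) (fracKer_nonneg z)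
  have hη : min (1 / 2) (κ / (1 + m₀)) * m₀ ≤ κ := by
    calc _ ≤ κ / (1 + m₀) * (1 + m₀) := by
          gcongr
          · exact min_le_right _ _
          · linarith
      _ = κ := by field_simp
  refine ⟨min (1 / 2) (κ / (1 + m₀)), by positivity, min_le_left _ _,
    fun r m b hr hm hb => ?_⟩
  set η := min (1 / 2) (κ / (1 + m₀))
  have hJ : Integrable (fun z : Euc n => (ball b r).indicator (1 : Euc n → ℝ) z * fracKer n s z) := by
    refine integrable_of_le_min_sq (C := 1 / min (r ^ 2) 1) hn hs0 hs1
      ((measurable_one.indicator measurableSet_ball).aestronglyMeasurable) fun z => ?_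
    by_cases hz : z ∈ ball b r
    · rw [indicator_of_mem hz, Pi.one_apply, abs_one, one_div, inv_mul_eq_div,
        one_le_div (by positivity)]
      have := (hb z hz).1
      gcongr
    · rw [indicator_of_notMem hz, abs_zero]
      positivity
  have hQ : Integrable (fun z : Euc n => min (‖z‖ ^ 2 / r ^ 2) 1 * fracKer n s z) := by
    refine integrable_of_le_min_sq (C := 1 / min (r ^ 2) 1) hn hs0 hs1
      (by fun_prop) fun z => ?_
    have h0 : 0 < min (r ^ 2) 1 := by positivity
    rw [abs_of_nonneg (by positivity), mul_min_of_nonneg _ _ (by positivity)]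
    gcongr
    · rw [div_eq_mul_inv, mul_comm, one_div]
      gcongr
      exact min_le_left _ _
    · rw [mul_one, one_le_div h0]; exact min_le_right _ _
  have hz0 : Integrable (fun z : Euc n => (0 : ℝ) * fracKer n s z) := by simp
  have h3 := integral_sub_sub_mul hJ hQ hz0 (1 / 4 * m) (η * m) 0
  simp only [zero_mul, sub_zero] at h3
  refine ⟨h3.1, ?_⟩
  rw [h3.2, integral_min_sq_div_ker hr]
  have h4 := le_integral_ker_of_ball hs0 (h := (ball b r).indicator 1)
    (fun z => indicator_nonneg (fun _ _ => zero_le_one) z) hJ (a := b) (R := 5 * r) (c := 1) hr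
    (fun z hz => ⟨by rw [indicator_of_mem hz]; rfl,
      hr.trans_le (hb z hz).1, (hb z hz).2⟩)
  have hpow : r ^ n * (5 * r) ^ (-((n : ℝ) + 2 * s)) =
      5 ^ (-((n : ℝ) + 2 * s)) * r ^ (-(2 * s)) := by
    rw [Real.mul_rpow (by norm_num) hr.le, ← Real.rpow_natCast r n, mul_left_comm,
      ← Real.rpow_add hr]
    congr 2; ring
  rw [one_mul, mul_assoc, hpow, ← mul_assoc] at h4
  have hr0 : 0 ≤ m * r ^ (-(2 * s)) := by positivity
  have h5 := mul_le_mul_of_nonneg_left h4 (by positivity : 0 ≤ 1 / 4 * m)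
  have h6 := mul_le_mul_of_nonneg_left hη hr0
  rw [hκ] at h6
  rw [← hm₀]
  linarith

set_option maxHeartbeats 800000 in
/-- The barriers dominate the solution; continuity up to the boundary is not assumed. -/
theorem exists_boundary_barrier (hn : 1 ≤ n) (hs0 : 0 < s) (hs1 : s < 1) {ρ : ℝ} (hρ : 0 < ρ)
    (hρ1 : ρ ≤ 1 / 16) (A : ℝ) :
    ∃ M > 0, ∀ (Ω : Set (Euc n)) (x₀ : Euc n) (u : Euc n → ℝ),
      BoundaryProblem n s A Ω x₀ ρ u →
      ∀ c ∈ ball x₀ (8 / 5), closedBall c ρ ⊆ Ωᶜ → ∀ y, u y ≤ M * barrier s c ρ y := by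
  obtain ⟨r₀, hr₀, hr₀1, hr₀ρ, hbar⟩ := exists_barrier_minorant (n := n) hn hs0 hs1 hρ (|A| + 1)
  obtain ⟨η, hη0, hη1, heta⟩ := exists_eta_minorant (n := n) hn hs0 hs1
  set M := 2 / r₀ ^ s with hM
  have hr₀s : r₀ ^ s ≤ 1 := Real.rpow_le_one hr₀.le (by linarith) hs0.le
  have hr₀p : 0 < r₀ ^ s := by positivity
  have hM1 : 1 ≤ M := by rw [hM, one_le_div hr₀p]; linarith
  refine ⟨M, by positivity, fun Ω x₀ u hP c hc hcΩ => ?_⟩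
  set w : Euc n → ℝ := fun y => u y - M * barrier s c ρ y with hw
  by_contra! hcon
  obtain ⟨y₀, hy₀⟩ := hcon
  have hb0 : ∀ y, 0 ≤ M * barrier s c ρ y := fun y =>
    mul_nonneg (by positivity) (barrier_nonneg hs0 c ρ y)
  have hbdd : BddAbove (range w) := ⟨1, by
    rintro _ ⟨y, rfl⟩
    linarith [hb0 y, (hP.bound y).2]⟩
  set m := sSup (range w) with hm
  have hwm : ∀ y, w y ≤ m := fun y => le_csSup hbdd ⟨y, rfl⟩
  have hm0 : 0 < m := lt_of_lt_of_le (sub_pos.2 hy₀) (hwm y₀)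
  have hloc : ∀ y, 0 < w y → y ∈ Ω ∧ ρ < ‖y - c‖ ∧ ‖y - c‖ < ρ + r₀ := fun y hy => by
    have h1 : ‖y - c‖ < ρ + r₀ := by
      by_contra! h
      have h2 : r₀ ≤ max (‖y - c‖ - ρ) 0 := le_trans (by linarith) (le_max_left _ _)
      have h3 := half_rpow_le_barrierProfile hs0 hr₀.le (by linarith) h2
      have h4 : 1 ≤ M * barrier s c ρ y := by
        calc 1 = M * (1 / 2 * r₀ ^ s) := by rw [hM]; field_simp
          _ ≤ _ := by gcongr; exact h3
      have h5 := (hP.bound y).2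
      simp only [hw] at hy
      linarith
    have h2 : y ∈ ball x₀ 2 := by
      have := dist_triangle y c x₀
      rw [mem_ball] at hc ⊢
      rw [dist_eq_norm y c] at this
      linarith
    have h3 : y ∈ Ω := by
      by_contra h
      have := hP.zero y ⟨h2, h⟩
      simp only [hw] at hy
      linarith [hb0 y]
    refine ⟨h3, ?_, h1⟩
    by_contra! h
    exact hcΩ (by rwa [mem_closedBall, dist_eq_norm]) h3
  obtain ⟨_, ⟨x, rfl⟩, hx⟩ := exists_lt_of_lt_csSup (range_nonempty w)
    (show (1 - η) * m < m by nlinarith)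
  have hx0 : 0 < w x := lt_of_le_of_lt (by nlinarith) hx
  obtain ⟨hxΩ, hxc1, hxc2⟩ := hloc x hx0
  have hcnΩ : c ∉ Ω := fun h => hcΩ (mem_closedBall_self hρ.le) h
  obtain ⟨p, hpf, hpd, hpmin⟩ := exists_nearest_boundary hP.isOpen hxΩ ⟨c, hcnΩ⟩
  set r := ‖x - p‖ / 2 with hr
  have hr0 : 0 < r := by positivity
  have hrρ : r ≤ ρ := by
    have := hpmin c hcnΩ
    linarith
  have hxx₀ : dist x x₀ < 8 / 5 + 2 * ρ := by
    have := dist_triangle x c x₀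
    rw [mem_ball] at hc
    rw [dist_eq_norm x c] at this
    linarith
  have hball : closedBall x r ⊆ Ω ∩ ball x₀ 2 := fun y hy => by
    rw [mem_closedBall] at hy
    refine ⟨?_, ?_⟩
    · by_contra h
      have := hpmin y h
      rw [dist_comm, dist_eq_norm] at hy
      linarith
    · have := dist_triangle y x x₀
      rw [mem_ball]
      linarith
  set K := η * m / r ^ 2 with hK
  have hK0 : 0 ≤ K := by positivity
  obtain ⟨x', hx', hmax⟩ := (isCompact_closedBall x r).exists_isMaxOn
    (f := fun y => w y - K * ‖y - x‖ ^ 2) ⟨x, mem_closedBall_self hr0.le⟩ (by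
      refine ContinuousOn.sub ((hP.cont.mono hball).sub ?_) (by fun_prop)
      exact (continuous_const.mul (continuous_barrier hs0 c ρ)).continuousOn)
  have hxx' : w x ≤ w x' - K * ‖x' - x‖ ^ 2 := by
    simpa using hmax (mem_closedBall_self hr0.le)
  have hglob : ∀ y, w y - K * ‖y - x‖ ^ 2 ≤ w x' - K * ‖x' - x‖ ^ 2 := fun y => by
    by_cases hy : y ∈ closedBall x r
    · exact hmax hy
    · rw [mem_closedBall, not_le, dist_eq_norm] at hy
      have : η * m ≤ K * ‖y - x‖ ^ 2 := by
        calc η * m = K * r ^ 2 := by rw [hK]; field_simp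
          _ ≤ _ := by gcongr
      linarith [hwm y]
  have hx'm : (1 - η) * m < w x' := by
    have : 0 ≤ K * ‖x' - x‖ ^ 2 := by positivity
    linarith
  obtain ⟨hx'Ω, hx'c1, hx'c2⟩ := hloc x' (lt_of_le_of_lt (by nlinarith) hx'm)
  have hx'd : dist x' x ≤ r := hx'
  have hpx₀ : p ∈ ball x₀ 2 := by
    have := dist_triangle p x x₀
    rw [dist_comm p x, dist_eq_norm x p] at this
    rw [mem_ball]
    linarith
  obtain ⟨ν, hν, -, hνΩ⟩ := (hP.twoSided p ⟨hpf, hpx₀⟩).mono hrρ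
  set b := p - r • ν - x' with hb
  have hbz : ∀ z ∈ ball b r, x' + z ∈ ball (p - r • ν) r := fun z hz => by
    rw [mem_ball, dist_eq_norm] at hz ⊢
    convert hz using 2
    rw [hb]; abel
  have hzpos : ∀ z ∈ ball b r, r ≤ ‖z‖ ∧ ‖z‖ ≤ 5 * r := fun z hz => by
    have h1 := hbz z hz
    have h2 := hpmin _ (hνΩ h1)
    have h3 : ‖x - (x' + z)‖ ≤ ‖x - x'‖ + ‖z‖ := by
      rw [← sub_sub]; exact norm_sub_le _ _
    rw [dist_comm, dist_eq_norm] at hx'd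
    refine ⟨by linarith, ?_⟩
    have h4 : ‖b‖ ≤ ‖x - p‖ + ‖r • ν‖ + ‖x - x'‖ := by
      have : b = -(x - p) - r • ν + (x - x') := by rw [hb]; abel
      rw [this]
      refine (norm_add_le _ _).trans ?_
      gcongr
      refine (norm_sub_le _ _).trans_eq ?_
      rw [norm_neg]
    rw [norm_smul, hν, Real.norm_of_nonneg hr0.le] at h4
    have h5 : ‖z‖ ≤ ‖z - b‖ + ‖b‖ := by simpa using norm_add_le (z - b) b
    rw [mem_ball, dist_eq_norm] at hz
    linarith
  obtain ⟨h₁, h₁i, h₁le, h₁int⟩ := hbar c x' hx'c1 hx'c2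
  obtain ⟨h₂i, h₂int⟩ := heta r m b hr0 hm0 hzpos
  obtain ⟨v, hvA, hv⟩ := hP.pv x' (hball hx')
  have hsum := hv.integral_le hn hs0 hs1 hP.meas hP.bound
    (h := fun z => M * h₁ z + (1 / 4 * m * (ball b r).indicator 1 z
        - η * m * min (‖z‖ ^ 2 / r ^ 2) 1)) (((h₁i.const_mul M).add h₂i).congr
        (.of_forall fun z => by simp only [Pi.add_apply]; ring)) (fun z => by
      have hone : ∀ z, -(η * m) ≤ w x' - w (x' + z) := fun z => by
        linarith [hwm (x' + z)]
      have hquad : -(2 * K * ‖z‖ ^ 2) ≤ 2 * w x' - w (x' + z) - w (x' + -z) := by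
        have e1 := hglob (x' + z)
        have e2 := hglob (x' + -z)
        have e3 : ‖x' + z - x‖ ^ 2 + ‖x' + -z - x‖ ^ 2 = 2 * ‖x' - x‖ ^ 2 + 2 * ‖z‖ ^ 2 := by
          have := parallelogram_law_with_norm ℝ (x' - x) z
          rw [show x' + z - x = x' - x + z by abel, show x' + -z - x = x' - x - z by abel]
          linarith
        have e4 : K * ‖x' + z - x‖ ^ 2 + K * ‖x' + -z - x‖ ^ 2 =
            K * (2 * ‖x' - x‖ ^ 2 + 2 * ‖z‖ ^ 2) := by rw [← mul_add, e3]
        linarith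
      have hwle : 2 * (1 / 4 * m * (ball b r).indicator 1 z - η * m * min (‖z‖ ^ 2 / r ^ 2) 1) ≤
          2 * w x' - w (x' + z) - w (x' + -z) := by
        by_cases hz : z ∈ ball b r
        · have e1 : 1 ≤ ‖z‖ ^ 2 / r ^ 2 := by
            rw [one_le_div (by positivity)]
            gcongr
            exact (hzpos z hz).1
          rw [indicator_of_mem hz, min_eq_right e1, Pi.one_apply]
          have e2 : w (x' + z) ≤ 0 := by
            have h1 := hbz z hz
            have h2 : x' + z ∈ ball x₀ 2 := by
              have e3 := dist_triangle4 (x' + z) (p - r • ν) p x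
              have e4 := dist_triangle (x' + z) x x₀
              rw [dist_eq_norm (p - r • ν) p, sub_sub_cancel_left, norm_neg, norm_smul, hν,
                Real.norm_of_nonneg hr0.le, dist_comm p x, dist_eq_norm x p] at e3
              rw [mem_ball] at h1 ⊢
              linarith
            have := hP.zero _ ⟨h2, hνΩ h1⟩
            simp only [hw]
            linarith [hb0 (x' + z)]
          have := hone (-z)
          nlinarith
        · rw [indicator_of_notMem hz]
          have e2 : K * ‖z‖ ^ 2 = η * m * (‖z‖ ^ 2 / r ^ 2) := by rw [hK]; ring
          rcases min_cases (‖z‖ ^ 2 / r ^ 2) 1 with ⟨h, -⟩ | ⟨h, -⟩ <;> rw [h]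
          · linarith
          · linarith [hone z, hone (-z)]
      have := mul_le_mul_of_nonneg_left (h₁le z) (by positivity : 0 ≤ M)
      simp only [hw] at hwle
      linarith)
  have hsplit : ∫ z, (M * h₁ z + (1 / 4 * m * (ball b r).indicator 1 z
        - η * m * min (‖z‖ ^ 2 / r ^ 2) 1)) * fracKer n s z =
      M * (∫ z, h₁ z * fracKer n s z) + ∫ z, (1 / 4 * m * (ball b r).indicator 1 z
        - η * m * min (‖z‖ ^ 2 / r ^ 2) 1) * fracKer n s z := by
    rw [← integral_const_mul, ← integral_add (h₁i.const_mul M) h₂i]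
    congr 1; ext z; ring
  rw [hsplit] at hsum
  have h5 : |A| + 1 ≤ M * ∫ z, h₁ z * fracKer n s z := by
    exact h₁int.trans (le_mul_of_one_le_left
      (le_trans (by linarith only [abs_nonneg A]) h₁int) hM1)
  linarith only [hsum, h₂int, h5, hvA, le_abs_self A, le_abs_self v]

/-- Boundary decay of the solution. -/
theorem exists_boundary_decay (hn : 1 ≤ n) (hs0 : 0 < s) (hs1 : s < 1) {ρ : ℝ} (hρ : 0 < ρ)
    (hρ1 : ρ ≤ 1 / 16) (A : ℝ) :
    ∃ M > 0, ∀ (Ω : Set (Euc n)) (x₀ : Euc n) (u : Euc n → ℝ),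
      BoundaryProblem n s A Ω x₀ ρ u →
      ∀ x ∈ ball x₀ (3 / 4), ∀ y ∉ Ω, u x ≤ M * ‖x - y‖ ^ s := by
  obtain ⟨M, hM, h⟩ := exists_boundary_barrier (n := n) hn hs0 hs1 hρ hρ1 A
  refine ⟨M, hM, fun Ω x₀ u hP x hx y hy => ?_⟩
  by_cases hxΩ : x ∈ Ω
  · obtain ⟨p, hpf, hpd, hpmin⟩ := exists_nearest_boundary hP.isOpen hxΩ ⟨y, hy⟩
    have hxp := hpmin x₀ hP.base
    rw [mem_ball] at hx
    rw [← dist_eq_norm, ← dist_eq_norm] at hxp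
    have hp := dist_triangle p x x₀
    rw [dist_comm p x] at hp
    obtain ⟨ν, hν, -, hνΩ⟩ := hP.twoSided p ⟨hpf, by rw [mem_ball]; linarith⟩
    have hν1 : ‖ρ • ν‖ = ρ := by rw [norm_smul, hν, Real.norm_of_nonneg hρ.le, mul_one]
    have hc : closedBall (p - ρ • ν) ρ ⊆ Ωᶜ := by
      rw [← closure_ball _ hρ.ne']
      exact closure_minimal hνΩ hP.isOpen.isClosed_compl
    have hcb : p - ρ • ν ∈ ball x₀ (8 / 5) := by
      have := dist_triangle (p - ρ • ν) p x₀
      rw [dist_eq_norm (p - ρ • ν) p, sub_sub_cancel_left, norm_neg, hν1] at this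
      rw [mem_ball]; linarith
    calc u x ≤ M * barrier s (p - ρ • ν) ρ x := h Ω x₀ u hP _ hcb hc x
      _ ≤ M * max (‖x - (p - ρ • ν)‖ - ρ) 0 ^ s := by
          gcongr
          exact barrierProfile_le_rpow hs0 (le_max_right _ _)
      _ ≤ M * ‖x - y‖ ^ s := by
          gcongr
          refine max_le ?_ (norm_nonneg _)
          have h1 := hpmin y hy
          have h2 := norm_add_le (x - p) (ρ • ν)
          rw [hν1, show x - p + ρ • ν = x - (p - ρ • ν) by abel] at h2
          linarith
  · rw [hP.zero x ⟨ball_subset_ball (by norm_num) hx, hxΩ⟩]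
    positivity

end BoundaryDecay

section Doubling

variable {n : ℕ} {s : ℝ}

theorem one_add_rpow_add_one_sub_rpow_le {α x : ℝ} (hα0 : 0 < α) (hα : α ≤ 1 / 2) (hx : |x| ≤ 1) :
    (1 + x) ^ α + (1 - x) ^ α ≤ 2 - α / 2 * x ^ 2 := by
  obtain ⟨hx1, hx2⟩ := abs_le.1 hx
  have hxx : x ^ 2 ≤ 1 := by nlinarith
  have bern : ∀ {t p : ℝ}, -1 ≤ t → 0 ≤ p → p ≤ 1 → (1 + t) ^ p ≤ 1 + p * t := fun h1 h2 h3 =>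
    rpow_one_add_le_one_add_mul_self h1 h2 h3
  have sq : ∀ {t : ℝ}, 0 ≤ t → (t ^ α) ^ 2 = t ^ (2 * α) := fun h => by
    rw [← Real.rpow_natCast, ← Real.rpow_mul h]; congr 1; push_cast; ring
  have h1 := bern (t := x) (p := 2 * α) hx1 (by linarith) (by linarith)
  have h2 := bern (t := -x) (p := 2 * α) (by linarith) (by linarith) (by linarith)
  have h3 := bern (t := -x ^ 2) (p := α) (by linarith) (by linarith) (by linarith)
  rw [← sub_eq_add_neg] at h2 h3
  rw [← sq (by linarith)] at h1 h2
  have h4 : (1 - x ^ 2) ^ α = (1 + x) ^ α * (1 - x) ^ α := by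
    rw [← Real.mul_rpow (by linarith) (by linarith)]; congr 1; ring
  rw [h4] at h3
  refine le_of_sq_le_sq ?_ (by nlinarith)
  nlinarith [sq_nonneg (α * x ^ 2)]

theorem add_rpow_add_sub_rpow_le {α T τ : ℝ} (hα0 : 0 < α) (hα : α ≤ 1 / 2) (hT : 0 < T)
    (hτ : 2 * |τ| ≤ T) :
    (T + 2 * τ) ^ α + (T - 2 * τ) ^ α ≤ 2 * T ^ α - 2 * (α * T ^ (α - 2) * τ ^ 2) := by
  have h := one_add_rpow_add_one_sub_rpow_le (x := 2 * τ / T) hα0 hα (by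
    rw [abs_div, abs_mul, abs_two, abs_of_pos hT, div_le_one hT]; exact hτ)
  obtain ⟨h1, h2⟩ := abs_le.1 (show |τ| ≤ T / 2 by linarith)
  have e1 : T + 2 * τ = T * (1 + 2 * τ / T) := by field_simp
  have e2 : T - 2 * τ = T * (1 - 2 * τ / T) := by field_simp
  have p1 : 0 ≤ 1 + 2 * τ / T := nonneg_of_mul_nonneg_right (by rw [← e1]; linarith) hT
  have p2 : 0 ≤ 1 - 2 * τ / T := nonneg_of_mul_nonneg_right (by rw [← e2]; linarith) hT
  rw [e1, e2, Real.mul_rpow hT.le p1, Real.mul_rpow hT.le p2, ← mul_add]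
  refine (mul_le_mul_of_nonneg_left h (by positivity)).trans_eq ?_
  rw [Real.rpow_sub hT, Real.rpow_two]
  field_simp

/-- Reflection through the hyperplane orthogonal to `e`. -/
def hyperplaneReflection (e : Euc n) : Euc n ≃ₗᵢ[ℝ] Euc n := (ℝ ∙ e)ᗮ.reflection

theorem hyperplaneReflection_apply {e : Euc n} (he : ‖e‖ = 1) (z : Euc n) :
    hyperplaneReflection e z = z - (2 * ⟪e, z⟫) • e := by
  rw [hyperplaneReflection, Submodule.reflection_orthogonal_apply,
    Submodule.reflection_singleton_apply]
  simp only [he, RCLike.ofReal_one, one_pow, div_one]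
  module

/-- A linear isometry acting inside a ball, and the identity outside. -/
def localIsometry (R : Euc n ≃ₗᵢ[ℝ] Euc n) (r : ℝ) (z : Euc n) : Euc n :=
  if ‖z‖ < r then R z else z

theorem localIsometry_of_lt {R : Euc n ≃ₗᵢ[ℝ] Euc n} {r : ℝ} {z : Euc n} (hz : ‖z‖ < r) :
    localIsometry R r z = R z := if_pos hz

theorem localIsometry_of_le {R : Euc n ≃ₗᵢ[ℝ] Euc n} {r : ℝ} {z : Euc n} (hz : r ≤ ‖z‖) :
    localIsometry R r z = z := if_neg hz.not_gt

theorem aestronglyMeasurable_comp_localIsometry {w : Euc n → ℝ} (hw : AEStronglyMeasurable w volume)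
    (R : Euc n ≃ₗᵢ[ℝ] Euc n) (r : ℝ) :
    AEStronglyMeasurable (fun z => w (localIsometry R r z)) volume := by
  classical
  have : (fun z => w (localIsometry R r z)) = (ball (0 : Euc n) r).piecewise (w ∘ R) w := by
    ext z
    by_cases hz : ‖z‖ < r <;> simp [localIsometry, Set.piecewise, hz]
  rw [this]
  exact AEStronglyMeasurable.piecewise measurableSet_ball
    (hw.comp_quasiMeasurePreserving R.measurePreserving.quasiMeasurePreserving).restrict hw.restrict

theorem setIntegral_trunc_localIsometry (hn : 1 ≤ n) (hs0 : 0 < s) (hs1 : s < 1) {w : Euc n → ℝ}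
    (hw : AEStronglyMeasurable w volume) {C : ℝ} (hC : ∀ z, |w z| ≤ C) (R : Euc n ≃ₗᵢ[ℝ] Euc n)
    (r : ℝ) {ε : ℝ} (hε : 0 < ε) :
    ∫ z in {z : Euc n | ε ≤ ‖z‖}, w (localIsometry R r z) * fracKer n s z =
      ∫ z in {z : Euc n | ε ≤ ‖z‖}, w z * fracKer n s z := by
  rw [← integral_inter_add_sdiff (t := ball (0 : Euc n) r) measurableSet_ball
      (integrableOn_bdd_ker hn hs0 hs1 hw hC hε),
    ← integral_inter_add_sdiff (t := ball (0 : Euc n) r) measurableSet_ball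
      (integrableOn_bdd_ker hn hs0 hs1 (aestronglyMeasurable_comp_localIsometry hw R r)
        (fun z => hC _) hε)]
  have hms := measurableSet_le_norm (n := n) ε
  congr 1
  · have hpre : R ⁻¹' ({z : Euc n | ε ≤ ‖z‖} ∩ ball 0 r) = {z : Euc n | ε ≤ ‖z‖} ∩ ball 0 r := by
      ext z; simp
    rw [← R.measurePreserving.setIntegral_preimage_emb R.toHomeomorph.measurableEmbedding
      (fun z => w z * fracKer n s z), hpre]
    refine setIntegral_congr_fun (hms.inter measurableSet_ball) fun z hz => ?_
    simp only [localIsometry_of_lt (R := R) (show ‖z‖ < r by simpa using hz.2), fracKer,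
      LinearIsometryEquiv.norm_map]
  · refine setIntegral_congr_fun (hms.diff measurableSet_ball) fun z hz => ?_
    simp only [localIsometry_of_le (R := R) (show r ≤ ‖z‖ by simpa using hz.2)]

/-- The kernel integral of the reflected difference of two principal values. -/
theorem HasPVAt.integral_le_sub (hn : 1 ≤ n) (hs0 : 0 < s) (hs1 : s < 1) {u h : Euc n → ℝ}
    {x y : Euc n} {v w : ℝ} (hx : HasPVAt n s u x v) (hy : HasPVAt n s u y w)
    (hum : AEStronglyMeasurable u volume) (hu : ∀ y, 0 ≤ u y ∧ u y ≤ 1)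
    (R : Euc n ≃ₗᵢ[ℝ] Euc n) (r : ℝ) (hi : Integrable (fun z => h z * fracKer n s z))
    (hle : ∀ z, 2 * h z ≤ (u x - u (x + z) - (u y - u (y + localIsometry R r z))) +
      (u x - u (x + -z) - (u y - u (y + localIsometry R r (-z))))) :
    ∫ z, h z * fracKer n s z ≤ v - w := by
  have hm : ∀ p, AEStronglyMeasurable (fun z => u p - u (p + z)) volume := fun p =>
    aestronglyMeasurable_const.sub (aestronglyMeasurable_comp_add hum p)
  have hb : ∀ p z, |u p - u (p + z)| ≤ 1 := fun p z => by
    rw [abs_le]; constructor <;> linarith [(hu p).1, (hu p).2, (hu (p + z)).1, (hu (p + z)).2]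
  have hI : ∀ ε > 0, IntegrableOn (fun z => (u x - u (x + z)) * fracKer n s z) {z | ε ≤ ‖z‖} :=
    fun ε hε => integrableOn_bdd_ker hn hs0 hs1 (hm x) (hb x) hε
  have hJ : ∀ ε > 0, IntegrableOn (fun z => (u y - u (y + localIsometry R r z)) * fracKer n s z)
      {z | ε ≤ ‖z‖} := fun ε hε =>
    integrableOn_bdd_ker hn hs0 hs1 (aestronglyMeasurable_comp_localIsometry (hm y) R r)
      (fun z => hb y _) hε
  refine integral_le_of_tendsto_trunc hs0 (fun ε hε => ?_) ?_ hi hle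
  · simp only [sub_mul _ (u y - _)]
    exact (hI ε hε).sub (hJ ε hε)
  · refine (hx.sub hy).congr' ?_
    filter_upwards [self_mem_nhdsWithin] with ε hε
    rw [← setIntegral_trunc_localIsometry hn hs0 hs1 (hm y) (hb y) R r hε,
      ← integral_sub (hI ε hε) (hJ ε hε)]
    simp only [sub_mul _ (u y - _)]

/-- The concavity gain of the doubling argument in the direction `e`. -/
theorem exists_doubling_minorant (hn : 1 ≤ n) (hs0 : 0 < s) (hs1 : s < 1) :
    ∃ κ > 0, ∃ m₀ ≥ 0, ∀ (e : Euc n) (T c Λ : ℝ), ‖e‖ = 1 → 0 < T → 0 ≤ c →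
      Integrable (fun z => (c * (ball (0 : Euc n) (T / 2)).indicator (fun z => ⟪e, z⟫ ^ 2) z
        - Λ * min (‖z‖ ^ 2) 1) * fracKer n s z) ∧
      c * (κ * T ^ (2 - 2 * s)) - Λ * m₀ ≤
        ∫ z, (c * (ball (0 : Euc n) (T / 2)).indicator (fun z => ⟪e, z⟫ ^ 2) z
          - Λ * min (‖z‖ ^ 2) 1) * fracKer n s z := by
  have hv : 0 < volume.real (ball (0 : Euc n) 1) :=
    ENNReal.toReal_pos (measure_ball_pos _ _ one_pos).ne' measure_ball_lt_top.ne
  refine ⟨1 / 64 * (volume.real (ball (0 : Euc n) 1) * (1 / 8) ^ n *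
      (1 / 2) ^ (-((n : ℝ) + 2 * s))), by positivity, ∫ z : Euc n, min (‖z‖ ^ 2) 1 * fracKer n s z,
    integral_nonneg fun z => mul_nonneg (by positivity) (fracKer_nonneg z),
    fun e T c Λ he hT hc => ?_⟩
  set h : Euc n → ℝ := (ball (0 : Euc n) (T / 2)).indicator (fun z => ⟪e, z⟫ ^ 2) with hh
  have hin : ∀ z, ⟪e, z⟫ ^ 2 ≤ ‖z‖ ^ 2 := fun z => by
    have := abs_real_inner_le_norm e z
    rw [he, one_mul] at this
    exact sq_le_sq.2 (by rwa [abs_norm])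
  have h0 : ∀ z, 0 ≤ h z := fun z => indicator_nonneg (fun _ _ => sq_nonneg _) z
  have hI : Integrable (fun z => h z * fracKer n s z) := by
    refine integrable_of_le_min_sq (C := 1 + T ^ 2) hn hs0 hs1
      ((by fun_prop : Measurable fun z : Euc n => ⟪e, z⟫ ^ 2).indicator
        measurableSet_ball).aestronglyMeasurable fun z => ?_
    rw [abs_of_nonneg (h0 z)]
    by_cases hz : z ∈ ball (0 : Euc n) (T / 2)
    · rw [hh, indicator_of_mem hz]
      rw [mem_ball_zero_iff] at hz
      have h3 : ‖z‖ ^ 2 ≤ T ^ 2 := by gcongr; linarith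
      rcases min_cases (‖z‖ ^ 2) 1 with ⟨h1, h2⟩ | ⟨h1, h2⟩ <;> rw [h1] <;>
        nlinarith [hin z, sq_nonneg T, sq_nonneg ‖z‖]
    · rw [hh, indicator_of_notMem hz]; positivity
  have hz0 : Integrable (fun z : Euc n => (0 : ℝ) * fracKer n s z) := by simp
  have h3 := integral_sub_sub_mul hI (integrable_min_sq_ker (s := s) hn hs0 hs1) hz0 c Λ 0
  simp only [zero_mul, sub_zero] at h3
  refine ⟨h3.1, ?_⟩
  rw [h3.2]
  gcongr
  have h4 := le_integral_ker_of_ball hs0 h0 hI (a := (T / 4) • e) (r := T * (1 / 8))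
    (R := T * (1 / 2)) (c := T ^ 2 / 64) (by positivity) (fun z hz => by
      rw [mem_ball, dist_eq_norm] at hz
      have h1 : |⟪e, z⟫ - T / 4| ≤ ‖z - (T / 4) • e‖ := by
        have := abs_real_inner_le_norm e (z - (T / 4) • e)
        rwa [inner_sub_right, inner_smul_right, real_inner_self_eq_norm_sq, he, one_mul, one_pow,
          mul_one] at this
      have h2 : T / 8 ≤ ⟪e, z⟫ := by linarith [(abs_le.1 h1).1]
      have h5 : ‖z‖ ≤ ‖z - (T / 4) • e‖ + T / 4 := by
        have := norm_add_le (z - (T / 4) • e) ((T / 4) • e)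
        rwa [sub_add_cancel, norm_smul, he, Real.norm_of_nonneg (by positivity), mul_one] at this
      have h6 : z ∈ ball (0 : Euc n) (T / 2) := by rw [mem_ball_zero_iff]; linarith
      refine ⟨?_, ?_, by linarith⟩
      · rw [hh, indicator_of_mem h6]; nlinarith
      · rw [norm_pos_iff]; rintro rfl; rw [inner_zero_right] at h2; linarith)
  refine le_trans (le_of_eq ?_) h4
  rw [mul_pow, Real.mul_rpow hT.le (by norm_num)]
  have : T ^ (2 - 2 * s) = T ^ 2 * (T ^ n * T ^ (-((n : ℝ) + 2 * s))) := by
    rw [← Real.rpow_natCast T n, ← Real.rpow_add hT, ← Real.rpow_two, ← Real.rpow_add hT]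
    congr 1; ring
  rw [this]
  ring

end Doubling

section Holder

variable {n : ℕ} {s : ℝ}

theorem BoundaryProblem.continuousOn_ball {A ρ M : ℝ} {Ω : Set (Euc n)} {x₀ : Euc n}
    {u : Euc n → ℝ} (hs0 : 0 < s) (hP : BoundaryProblem n s A Ω x₀ ρ u)
    (hM : ∀ x ∈ ball x₀ (3 / 4), ∀ y ∉ Ω, u x ≤ M * ‖x - y‖ ^ s) :
    ContinuousOn u (ball x₀ (3 / 4)) := by
  intro x hx
  have hx2 : x ∈ ball x₀ 2 := ball_subset_ball (by norm_num) hx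
  by_cases hxΩ : x ∈ Ω
  · exact (hP.cont.continuousAt ((hP.isOpen.inter isOpen_ball).mem_nhds ⟨hxΩ, hx2⟩)).continuousWithinAt
  · have h0 : u x = 0 := hP.zero x ⟨hx2, hxΩ⟩
    rw [ContinuousWithinAt, h0]
    have hc : Continuous fun y : Euc n => M * ‖y - x‖ ^ s := by fun_prop (disch := exact hs0.le)
    have ht : Tendsto (fun y : Euc n => M * ‖y - x‖ ^ s) (𝓝[ball x₀ (3 / 4)] x) (𝓝 0) := by
      have := hc.tendsto x
      rw [sub_self, norm_zero, Real.zero_rpow hs0.ne', mul_zero] at this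
      exact this.mono_left nhdsWithin_le_nhds
    refine tendsto_of_tendsto_of_tendsto_of_le_of_le' tendsto_const_nhds ht
      (.of_forall fun y => (hP.bound y).1) ?_
    filter_upwards [self_mem_nhdsWithin] with y hy using hM y hy x hxΩ

/-- The penalized doubled difference. -/
def doubledDiff (u : Euc n → ℝ) (L α : ℝ) (c x y : Euc n) : ℝ :=
  u x - u y - L * ‖x - y‖ ^ α - 256 * ‖x - c‖ ^ 2

theorem exists_max_doubledDiff {u : Euc n → ℝ} {L α : ℝ} {x₀ : Euc n} (hα : 0 < α)
    (hu : ∀ y, 0 ≤ u y ∧ u y ≤ 1) (hc : ContinuousOn u (ball x₀ (3 / 4)))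
    (hL : 1 ≤ L * (1 / 16) ^ α) {a b : Euc n} (ha : a ∈ ball x₀ (1 / 2))
    (hlt : L * ‖a - b‖ ^ α < u a - u b) :
    ∃ x ∈ ball x₀ (3 / 4), ∃ y ∈ ball x₀ (3 / 4), 0 < doubledDiff u L α a x y ∧
      (∀ p q, doubledDiff u L α a p q ≤ doubledDiff u L α a x y) ∧ ‖x - y‖ ≤ 3 / 16 := by
  have hL0 : 0 < L := by
    have : (0 : ℝ) < (1 / 16) ^ α := by positivity
    nlinarith
  set F : Euc n × Euc n → ℝ := fun p => doubledDiff u L α a p.1 p.2 with hF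
  set K : Set (Euc n × Euc n) := closedBall a (1 / 16) ×ˢ closedBall a (1 / 8) with hK
  have hout : ∀ p ∉ K, F p ≤ 0 := by
    rintro ⟨p, q⟩ hpq
    have h1 : u p - u q ≤ 1 := by linarith [(hu p).2, (hu q).1]
    have h2 : 0 ≤ L * ‖p - q‖ ^ α := by positivity
    simp only [hF, doubledDiff]
    by_cases hp : p ∈ closedBall a (1 / 16)
    · have hq : q ∉ closedBall a (1 / 8) := fun hq => hpq ⟨hp, hq⟩
      rw [mem_closedBall, dist_eq_norm] at hp hq
      have h3 : 1 / 16 ≤ ‖p - q‖ := by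
        have := norm_sub_norm_le (q - a) (p - a)
        rw [sub_sub_sub_cancel_right, norm_sub_rev q p] at this
        linarith
      have h4 : L * (1 / 16) ^ α ≤ L * ‖p - q‖ ^ α := by gcongr
      nlinarith [sq_nonneg ‖p - a‖]
    · rw [mem_closedBall, dist_eq_norm, not_le] at hp
      nlinarith
  have hab : 0 < F (a, b) := by
    simp only [hF, doubledDiff, sub_self, norm_zero]
    linarith
  have habK : (a, b) ∈ K := by
    by_contra h
    exact absurd (hout _ h) (not_le.2 hab)
  have hsub : ∀ r ≤ (1 / 8 : ℝ), closedBall a r ⊆ ball x₀ (3 / 4) := fun r hr => by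
    refine closedBall_subset_ball' ?_
    rw [mem_ball] at ha
    linarith
  have hcF : ContinuousOn F K := by
    have h1 : ContinuousOn (fun p : Euc n × Euc n => u p.1) K :=
      hc.comp continuousOn_fst fun p hp => hsub _ (by norm_num) hp.1
    have h2 : ContinuousOn (fun p : Euc n × Euc n => u p.2) K :=
      hc.comp continuousOn_snd fun p hp => hsub _ le_rfl hp.2
    have h3 : Continuous fun p : Euc n × Euc n => L * ‖p.1 - p.2‖ ^ α := by
      fun_prop (disch := exact hα.le)
    exact ((h1.sub h2).sub h3.continuousOn).sub (by fun_prop)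
  obtain ⟨⟨x, y⟩, hxy, hmax⟩ := ((isCompact_closedBall a _).prod
    (isCompact_closedBall a _)).exists_isMaxOn ⟨_, habK⟩ hcF
  have hpos : 0 < F (x, y) := hab.trans_le (hmax habK)
  refine ⟨x, hsub _ (by norm_num) hxy.1, y, hsub _ le_rfl hxy.2, hpos, fun p q => ?_, ?_⟩
  · by_cases h : (p, q) ∈ K
    · exact hmax h
    · exact (hout _ h).trans hpos.le
  · have h1 := mem_closedBall.1 hxy.1
    have h2 := mem_closedBall.1 hxy.2
    have := dist_triangle_right x y a
    rw [← dist_eq_norm]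
    simp only at h1 h2
    linarith

theorem add_sub_add_hyperplaneReflection {x y z e : Euc n} {T : ℝ} (he : ‖e‖ = 1)
    (hxy : x - y = T • e) :
    x + z - (y + hyperplaneReflection e z) = (T + 2 * ⟪e, z⟫) • e := by
  rw [hyperplaneReflection_apply he, add_smul, ← hxy]
  abel

/-- Symmetrized lower bound at a maximum of the doubled difference. -/
theorem doubledDiff_minorant {u : Euc n → ℝ} {L α : ℝ} {c x y e : Euc n} {T : ℝ} (hα0 : 0 < α)
    (hα : α ≤ 1 / 2) (hL : 0 ≤ L) (hu : ∀ y, 0 ≤ u y ∧ u y ≤ 1)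
    (hmax : ∀ p q, doubledDiff u L α c p q ≤ doubledDiff u L α c x y)
    (he : ‖e‖ = 1) (hT : 0 < T) (hT1 : T ≤ 1) (hxy : x - y = T • e) (z : Euc n) :
    2 * (L * α * T ^ (α - 2) * (ball (0 : Euc n) (T / 2)).indicator (fun z => ⟪e, z⟫ ^ 2) z
        - 256 * min (‖z‖ ^ 2) 1) ≤
      (u x - u (x + z) - (u y - u (y + localIsometry (hyperplaneReflection e) (T / 2) z))) +
      (u x - u (x + -z) -
        (u y - u (y + localIsometry (hyperplaneReflection e) (T / 2) (-z)))) := by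
  have hpar : ‖x + z - c‖ ^ 2 + ‖x + -z - c‖ ^ 2 = 2 * ‖x - c‖ ^ 2 + 2 * ‖z‖ ^ 2 := by
    have := parallelogram_law_with_norm ℝ (x - c) z
    rw [show x - c + z = x + z - c by abel, show x - c - z = x + -z - c by abel] at this
    linarith
  have hnT : ‖x - y‖ = T := by rw [hxy, norm_smul, he, mul_one, Real.norm_of_nonneg hT.le]
  rcases lt_or_ge ‖z‖ (T / 2) with hz | hz
  · rw [indicator_of_mem (by rwa [mem_ball_zero_iff]), localIsometry_of_lt hz,
      localIsometry_of_lt (by rwa [norm_neg])]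
    have hτ : |⟪e, z⟫| ≤ ‖z‖ := by simpa [he] using abs_real_inner_le_norm e z
    have key := add_rpow_add_sub_rpow_le (τ := ⟪e, z⟫) hα0 hα hT (by linarith)
    have hb := abs_le.1 hτ
    have h1 := hmax (x + z) (y + hyperplaneReflection e z)
    have h2 := hmax (x + -z) (y + hyperplaneReflection e (-z))
    simp only [doubledDiff, add_sub_add_hyperplaneReflection he hxy, norm_smul, he, mul_one,
      inner_neg_right, Real.norm_eq_abs, hnT] at h1 h2
    rw [abs_of_nonneg (by linarith)] at h1 h2
    rw [show T + 2 * -⟪e, z⟫ = T - 2 * ⟪e, z⟫ by ring] at h2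
    have h3 := mul_le_mul_of_nonneg_left key hL
    rw [min_eq_left (by nlinarith [norm_nonneg z])]
    linarith only [h1, h2, h3, hpar]
  · rw [indicator_of_notMem (by simpa using hz), localIsometry_of_le hz,
      localIsometry_of_le (by rwa [norm_neg])]
    have h1 := hmax (x + z) (y + z)
    have h2 := hmax (x + -z) (y + -z)
    simp only [doubledDiff, add_sub_add_right_eq_sub] at h1 h2
    rcases min_cases (‖z‖ ^ 2) 1 with ⟨h, -⟩ | ⟨h, -⟩ <;> rw [h]
    · linarith only [h1, h2, hpar]
    · linarith only [hu x, hu y, hu (x + z), hu (x + -z), hu (y + z), hu (y + -z)]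

/-- Interior and boundary Hölder estimate for the normalized problem. -/
theorem exists_holder_bound (hn : 1 ≤ n) (hs0 : 0 < s) (hs1 : s < 1) {ρ : ℝ} (hρ : 0 < ρ)
    (hρ1 : ρ ≤ 1 / 16) (A : ℝ) {α : ℝ} (hα0 : 0 < α) (hα : α ≤ 1 / 2) (hαs : α ≤ s) :
    ∃ L > 0, ∀ (Ω : Set (Euc n)) (x₀ : Euc n) (u : Euc n → ℝ), BoundaryProblem n s A Ω x₀ ρ u →
      ∀ a ∈ ball x₀ (1 / 2), ∀ b ∈ ball x₀ (1 / 2), u a - u b ≤ L * ‖a - b‖ ^ α := by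
  obtain ⟨M, hM0, hM⟩ := exists_boundary_decay hn hs0 hs1 hρ hρ1 A
  obtain ⟨κ, hκ, m₀, hm₀, hmin⟩ := exists_doubling_minorant (n := n) hn hs0 hs1
  set Q := 2 * |A| + 256 * m₀ + 1 with hQ
  have hQ0 : 0 < Q := by positivity
  set L := M + (16 : ℝ) ^ α + Q / (α * κ) with hL
  have hL0 : 0 < L := by positivity
  have hLM : M ≤ L := by
    have : 0 < (16 : ℝ) ^ α + Q / (α * κ) := by positivity
    linarith
  have hL16 : 1 ≤ L * (1 / 16) ^ α := by
    have h1 : (16 : ℝ) ^ α * (1 / 16) ^ α = 1 := by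
      rw [← Real.mul_rpow (by norm_num) (by norm_num)]; norm_num
    have h2 : (16 : ℝ) ^ α ≤ L := by
      have : 0 < M + Q / (α * κ) := by positivity
      linarith
    refine h1.symm.trans_le ?_
    gcongr
  have hLQ : Q ≤ L * α * κ := by
    have h1 : Q / (α * κ) ≤ L := by
      have : 0 < M + (16 : ℝ) ^ α := by positivity
      linarith
    rwa [div_le_iff₀ (by positivity), ← mul_assoc] at h1
  refine ⟨L, hL0, fun Ω x₀ u hP a ha b _ => ?_⟩
  by_contra! hlt
  have hdec := hM Ω x₀ u hP
  obtain ⟨x, hx, y, hy, hpos, hmax, hd⟩ := exists_max_doubledDiff hα0 hP.bound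
    (hP.continuousOn_ball hs0 hdec) hL16 ha hlt
  have hb2 : ball x₀ (3 / 4) ⊆ ball x₀ 2 := ball_subset_ball (by norm_num)
  have hlt' : L * ‖x - y‖ ^ α < u x - u y := by
    have := sq_nonneg ‖x - a‖
    simp only [doubledDiff] at hpos
    linarith
  have hLn : 0 ≤ L * ‖x - y‖ ^ α := by positivity
  have hT : 0 < ‖x - y‖ := norm_sub_pos_iff.2 fun h => by
    rw [h] at hlt' hLn
    linarith
  have hxΩ : x ∈ Ω := by
    by_contra h
    have := hP.zero x ⟨hb2 hx, h⟩
    linarith [(hP.bound y).1]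
  have hyΩ : y ∈ Ω := by
    by_contra h
    have h1 : M * ‖x - y‖ ^ s ≤ L * ‖x - y‖ ^ α :=
      mul_le_mul hLM (Real.rpow_le_rpow_of_exponent_ge hT (by linarith) hαs) (by positivity) hL0.le
    linarith [hdec x hx y h, (hP.bound y).1]
  obtain ⟨v, hv, hpv⟩ := hP.pv x ⟨hxΩ, hb2 hx⟩
  obtain ⟨w, hw, hpw⟩ := hP.pv y ⟨hyΩ, hb2 hy⟩
  set T := ‖x - y‖ with hTdef
  set e := T⁻¹ • (x - y) with he
  have he1 : ‖e‖ = 1 := by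
    rw [he, norm_smul, norm_inv, Real.norm_of_nonneg hT.le, ← hTdef, inv_mul_cancel₀ hT.ne']
  have hxy : x - y = T • e := by rw [he, smul_inv_smul₀ hT.ne']
  obtain ⟨hi, hge⟩ := hmin e T (L * α * T ^ (α - 2)) 256 he1 hT (by positivity)
  have hup := hpv.integral_le_sub hn hs0 hs1 hpw hP.meas hP.bound (hyperplaneReflection e) (T / 2)
    hi (doubledDiff_minorant hα0 hα hL0.le hP.bound hmax he1 hT (by linarith) hxy)
  have hpow : 1 ≤ T ^ (α - 2) * T ^ (2 - 2 * s) := by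
    rw [← Real.rpow_add hT]
    exact Real.one_le_rpow_of_pos_of_le_one_of_nonpos hT (by linarith) (by linarith)
  have hfin : L * α * κ ≤ L * α * T ^ (α - 2) * (κ * T ^ (2 - 2 * s)) := by
    calc L * α * κ = L * α * κ * 1 := by ring
      _ ≤ L * α * κ * (T ^ (α - 2) * T ^ (2 - 2 * s)) := by gcongr
      _ = _ := by ring
  have := le_abs_self A
  linarith only [hfin, hge, hup, hLQ, hQ, this, abs_le.1 hv, abs_le.1 hw]

end Holder

section Localization

variable {n : ℕ} {s : ℝ}

theorem fracC_pos (hs0 : 0 < s) (hs1 : s < 1) : 0 < fracC n s := by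
  have h1 : 0 < Real.Gamma ((n : ℝ) / 2 + s) := Real.Gamma_pos_of_pos (by positivity)
  have h2 : 0 < Real.Gamma (1 - s) := Real.Gamma_pos_of_pos (by linarith)
  unfold fracC
  positivity

theorem HasFracLapAt.hasPVAt (hs0 : 0 < s) (hs1 : s < 1) {u : Euc n → ℝ} {x : Euc n} {v : ℝ}
    (h : HasFracLapAt n s u x v) : HasPVAt n s u x (v / fracC n s) := by
  have hc := fracC_pos (n := n) hs0 hs1
  refine (h.div_const (fracC n s)).congr fun ε => ?_
  rw [mul_div_cancel_left₀ _ hc.ne', ← (measurePreserving_add_left volume x).setIntegral_preimage_emb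
    (measurableEmbedding_addLeft x) (fun y => (u x - u y) / dist x y ^ ((n : ℝ) + 2 * s))]
  simp [fracKer, div_eq_mul_inv]

/-- Functions in `L_{2s}` are integrable against the kernel away from its pole. -/
theorem MemL2s.integrableOn_ker (hs0 : 0 < s) {u : Euc n → ℝ} (hu : MemL2s n s u) (x : Euc n)
    {ε : ℝ} (hε : 0 < ε) :
    IntegrableOn (fun z => u (x + z) * fracKer n s z) {z | ε ≤ ‖z‖} := by
  have hp : 0 < (n : ℝ) + 2 * s := by positivity
  set p := (n : ℝ) + 2 * s with hpdef
  have hms : MeasurableSet {y : Euc n | ε ≤ ‖y - x‖} :=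
    measurableSet_le measurable_const (by fun_prop)
  have hmk : Measurable fun y : Euc n => fracKer n s (y - x) :=
    measurable_fracKer.comp (measurable_id.sub_const x)
  have hI : Integrable ({y : Euc n | ε ≤ ‖y - x‖}.indicator fun y => u y * fracKer n s (y - x)) := by
    refine (hu.2.const_mul ((ε ^ p)⁻¹ + (1 + ‖x‖ / ε) ^ p)).mono'
      ((hu.1.aestronglyMeasurable.mul hmk.aestronglyMeasurable).indicator hms)
      (.of_forall fun y => ?_)
    by_cases hy : y ∈ {y : Euc n | ε ≤ ‖y - x‖}
    · have hyx : ε ≤ ‖y - x‖ := hy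
      have h0 : 0 < ‖y - x‖ := hε.trans_le hyx
      have h1 : ‖y‖ ≤ ‖y - x‖ * (1 + ‖x‖ / ε) := by
        have h2 := norm_add_le (y - x) x
        rw [sub_add_cancel] at h2
        have h3 : ‖x‖ ≤ ‖y - x‖ * (‖x‖ / ε) := by
          rw [mul_div_assoc', le_div_iff₀ hε, mul_comm]
          gcongr
        linarith
      have h4 : ‖y‖ ^ p ≤ ‖y - x‖ ^ p * (1 + ‖x‖ / ε) ^ p := by
        rw [← Real.mul_rpow (norm_nonneg _) (by positivity)]
        gcongr
      have h5 : 1 ≤ ‖y - x‖ ^ p * (ε ^ p)⁻¹ := by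
        rw [← div_eq_mul_inv, one_le_div (by positivity)]
        gcongr
      rw [indicator_of_mem hy, norm_mul, Real.norm_eq_abs, Real.norm_of_nonneg (fracKer_nonneg _),
        fracKer, ← hpdef, mul_div_assoc', le_div_iff₀ (by positivity), ← div_eq_mul_inv,
        div_mul_eq_mul_div, div_le_iff₀ (by positivity)]
      calc |u y| * (1 + ‖y‖ ^ p) ≤
          |u y| * (‖y - x‖ ^ p * (ε ^ p)⁻¹ + ‖y - x‖ ^ p * (1 + ‖x‖ / ε) ^ p) := by gcongr
        _ = _ := by ring
    · rw [indicator_of_notMem hy, norm_zero]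
      positivity
  rw [← integrable_indicator_iff (measurableSet_le_norm ε)]
  refine (hI.comp_add_left x).congr (.of_forall fun z => ?_)
  simp [indicator]

/-- Where a nonnegative function is touched from below by a paraboloid, the tail is controlled by
the fractional Laplacian. -/
theorem setIntegral_tail_le_of_touching (hn : 1 ≤ n) (hs0 : 0 < s) (hs1 : s < 1) {u : Euc n → ℝ}
    (hu0 : ∀ y, 0 ≤ u y) (hu : MemL2s n s u) {x p : Euc n} {B v : ℝ} (hx : u x ≤ B)
    (hmin : ∀ y, u x + B * ‖x - p‖ ^ 2 ≤ u y + B * ‖y - p‖ ^ 2) (hpv : HasPVAt n s u x v) :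
    ∫ z in {z : Euc n | 1 ≤ ‖z‖}, u (x + z) * fracKer n s z ≤
      2 * (B * (∫ z : Euc n, min (‖z‖ ^ 2) 1 * fracKer n s z) - v) := by
  have hI := (integrable_indicator_iff (measurableSet_le_norm 1)).2
    (hu.integrableOn_ker hs0 x one_pos)
  have hJ : Integrable (fun z : Euc n =>
      {z : Euc n | 1 ≤ ‖z‖}.indicator (fun z => u (x + z)) z * fracKer n s z) :=
    hI.congr (.of_forall fun z => indicator_mul_left _ _ _)
  have hz0 : Integrable (fun z : Euc n => (0 : ℝ) * fracKer n s z) := by simp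
  have h3 := integral_sub_sub_mul hJ (integrable_min_sq_ker (s := s) hn hs0 hs1) hz0 (1 / 2) B 0
  simp only [zero_mul, sub_zero] at h3
  have hneg : Tendsto (fun ε : ℝ => ∫ z in {z : Euc n | ε ≤ ‖z‖}, (u (x + z) - u x) * fracKer n s z)
      (𝓝[>] 0) (𝓝 (-v)) := by
    refine (Tendsto.neg hpv).congr fun ε => ?_
    rw [← integral_neg]
    congr 1 with z
    ring
  have key := integral_le_of_tendsto_trunc hs0 (fun ε hε => ?_) hneg h3.1 fun z => ?_
  · rw [h3.2] at key
    rw [← integral_indicator (measurableSet_le_norm 1)]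
    have : ∀ z, {z : Euc n | 1 ≤ ‖z‖}.indicator (fun z => u (x + z) * fracKer n s z) z =
      {z : Euc n | 1 ≤ ‖z‖}.indicator (fun z => u (x + z)) z * fracKer n s z := fun z =>
      indicator_mul_left _ _ _
    simp only [this]
    linarith
  · simp only [sub_mul]
    exact (hu.integrableOn_ker hs0 x hε).sub (integrableOn_bdd_ker (f := fun _ => u x) hn hs0 hs1
      aestronglyMeasurable_const (fun _ => le_rfl) hε)
  · by_cases hz : 1 ≤ ‖z‖
    · rw [indicator_of_mem (by exact hz), min_eq_right (by nlinarith)]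
      linarith [hu0 (x + -z), hu0 (x + z)]
    · rw [indicator_of_notMem (by exact hz), min_eq_left (by nlinarith [norm_nonneg z])]
      have hpar := parallelogram_law_with_norm ℝ (x - p) z
      rw [show x - p + z = x + z - p by abel, show x - p - z = x + -z - p by abel] at hpar
      have h1 := hmin (x + z)
      have h2 := hmin (x + -z)
      have h4 : B * ‖x + z - p‖ ^ 2 + B * ‖x + -z - p‖ ^ 2 =
          2 * (B * ‖x - p‖ ^ 2) + 2 * (B * ‖z‖ ^ 2) := by linear_combination B * hpar
      linarith

/-- Cutting off a function away from `x` changes the principal value by an integral. -/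
theorem HasPVAt.indicator (hn : 1 ≤ n) (hs0 : 0 < s) (hs1 : s < 1) {u : Euc n → ℝ}
    (hu : MemL2s n s u) {S : Set (Euc n)} (hS : MeasurableSet S) {x : Euc n} {v δ : ℝ} (hδ : 0 < δ)
    (hb : ball x δ ⊆ S) (hpv : HasPVAt n s u x v) :
    Integrable (fun z => Sᶜ.indicator u (x + z) * fracKer n s z) ∧
    HasPVAt n s (S.indicator u) x (v + ∫ z, Sᶜ.indicator u (x + z) * fracKer n s z) := by
  have hxS : x ∈ S := hb (mem_ball_self hδ)
  have hmS : MeasurableSet {z | x + z ∈ Sᶜ} := (measurable_const_add x) hS.compl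
  have hI : Integrable (fun z => Sᶜ.indicator u (x + z) * fracKer n s z) := by
    refine (((integrable_indicator_iff (measurableSet_le_norm δ)).2
      (hu.integrableOn_ker hs0 x hδ)).indicator hmS).congr (.of_forall fun z => ?_)
    by_cases hz : x + z ∈ S
    · simp [hz]
    · have hδz : δ ≤ ‖z‖ := by
        by_contra! h
        exact hz (hb (by simpa [dist_eq_norm] using h))
      simp [hz, hδz]
  refine ⟨hI, (hpv.add (tendsto_trunc_integral hs0 hI)).congr' ?_⟩
  filter_upwards [self_mem_nhdsWithin] with ε hε
  rw [← integral_add _ hI.integrableOn]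
  · congr 1 with z
    rw [← add_mul, indicator_of_mem hxS]
    congr 1
    have := congrFun (indicator_self_add_compl S u) (x + z)
    rw [Pi.add_apply] at this
    linarith
  · simp only [sub_mul]
    exact (integrableOn_bdd_ker (f := fun _ => u x) hn hs0 hs1
      aestronglyMeasurable_const (fun _ => le_rfl) hε).sub (hu.integrableOn_ker hs0 x hε)

/-- Comparison of tails seen from two different points. -/
theorem integral_tail_le_of_norm_le (hs0 : 0 < s) {w : Euc n → ℝ} (hw : ∀ y, 0 ≤ w y)
    {x y : Euc n} {c : ℝ} (hc : 0 < c)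
    (hx : Integrable (fun z => w (x + z) * fracKer n s z))
    (hy : Integrable (fun z => w (y + z) * fracKer n s z))
    (hxy : ∀ q, w q ≠ 0 → ‖q - y‖ ≤ c * ‖q - x‖ ∧ 0 < ‖q - y‖) :
    ∫ z, w (x + z) * fracKer n s z ≤
      c ^ ((n : ℝ) + 2 * s) * ∫ z, w (y + z) * fracKer n s z := by
  have hp : 0 < (n : ℝ) + 2 * s := by positivity
  have hx' := hx.comp_sub_right x
  have hy' := hy.comp_sub_right y
  rw [← integral_sub_right_eq_self _ x, ← integral_sub_right_eq_self (fun z => w (y + z) * _) y,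
    ← integral_const_mul]
  refine integral_mono hx' (hy'.const_mul _) fun q => ?_
  simp only [add_sub_cancel]
  rcases eq_or_ne (w q) 0 with h | h
  · simp [h]
  · obtain ⟨h1, h2⟩ := hxy q h
    have h3 : 0 < ‖q - x‖ := pos_of_mul_pos_right (h2.trans_le h1) hc.le
    rw [mul_left_comm]
    refine mul_le_mul_of_nonneg_left ?_ (hw q)
    rw [fracKer, fracKer, inv_le_iff_one_le_mul₀ (by positivity), mul_assoc, mul_left_comm,
      ← div_eq_inv_mul, one_le_div (by positivity), ← Real.mul_rpow hc.le (norm_nonneg _)]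
    gcongr

theorem C11LocOn.continuousOn {u : Euc n → ℝ} {Ω : Set (Euc n)} (h : C11LocOn n u Ω) :
    ContinuousOn u Ω := fun x hx => by
  obtain ⟨ε, hε, -, hC, -⟩ := h x hx
  exact (hC.continuousOn.continuousAt (ball_mem_nhds x hε)).continuousWithinAt

/-- Existence of an interior point at controlled position where the tail is controlled. -/
theorem exists_tail_le (hn : 1 ≤ n) (hs0 : 0 < s) (hs1 : s < 1) {r : ℝ} (hr : 0 < r)
    (hr1 : r ≤ 1) : ∃ C > 0, ∀ (u g : Euc n → ℝ) (p : Euc n) (Kg Ku : ℝ), (∀ x, 0 ≤ u x) →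
      MemL2s n s u → ContinuousOn u (closedBall p r) → (∀ x ∈ closedBall p r, u x ≤ Ku) →
      (∀ x ∈ closedBall p r, |g x| ≤ Kg) →
      (∀ x ∈ closedBall p r, HasPVAt n s u x (g x / fracC n s)) →
      ∃ x ∈ closedBall p r,
        ∫ z in {z : Euc n | 1 ≤ ‖z‖}, u (x + z) * fracKer n s z ≤ C * (Ku + Kg) := by
  have hc := fracC_pos (n := n) hs0 hs1
  set m₀ := ∫ z : Euc n, min (‖z‖ ^ 2) 1 * fracKer n s z with hm₀
  have hm₀0 : 0 ≤ m₀ := integral_nonneg fun z => mul_nonneg (by positivity) (fracKer_nonneg z)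
  refine ⟨2 * (m₀ / r ^ 2 + 1 / fracC n s), by positivity,
    fun u g p Kg Ku hu0 hu hcont hKu hKg hpv => ?_⟩
  have hp : p ∈ closedBall p r := mem_closedBall_self hr.le
  have hKu0 : 0 ≤ Ku := (hu0 p).trans (hKu p hp)
  have hKg0 : 0 ≤ Kg := (abs_nonneg _).trans (hKg p hp)
  set B := Ku / r ^ 2 with hB
  have hB0 : 0 ≤ B := by positivity
  have hBr : B * r ^ 2 = Ku := by rw [hB]; field_simp
  obtain ⟨x, hx, hmin⟩ := (isCompact_closedBall p r).exists_isMinOn ⟨p, hp⟩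
    (f := fun y => u y + B * ‖y - p‖ ^ 2) (hcont.add (by fun_prop))
  have hglob : ∀ y, u x + B * ‖x - p‖ ^ 2 ≤ u y + B * ‖y - p‖ ^ 2 := fun y => by
    by_cases hy : y ∈ closedBall p r
    · exact hmin hy
    · have h1 := hmin hp
      simp only [mem_ofPred_eq, sub_self, norm_zero] at h1
      rw [mem_closedBall, dist_eq_norm, not_le] at hy
      have h2 : B * r ^ 2 ≤ B * ‖y - p‖ ^ 2 := by gcongr
      linarith [hKu p hp, hu0 y]
  have hKB : Ku ≤ B := by
    rw [hB, le_div_iff₀ (by positivity)]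
    exact mul_le_of_le_one_right hKu0 (pow_le_one₀ hr.le hr1)
  refine ⟨x, hx, (setIntegral_tail_le_of_touching hn hs0 hs1 hu0 hu ((hKu x hx).trans hKB)
    hglob (hpv x hx)).trans ?_⟩
  rw [← hm₀]
  have h1 : -(g x / fracC n s) ≤ 1 / fracC n s * Kg := by
    rw [← neg_div, div_mul_eq_mul_div, one_mul]
    gcongr
    linarith [(abs_le.1 (hKg x hx)).1]
  have h2 : B * m₀ = m₀ / r ^ 2 * Ku := by rw [hB]; ring
  have h3 : 0 ≤ m₀ / r ^ 2 * Kg := by positivity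
  have h4 : 0 ≤ 1 / fracC n s * Ku := by positivity
  linarith

end Localization

/-- local boundary `C^{α₀}` regularity, `α₀ = min(s, 1-s)`:
same setting as the boundary `C^s` estimate, with conclusion
`‖u‖_{C^{α₀}(Ω ∩ B_{1/2})} ≤ C (‖u‖_{L^∞(Ω∩B₄)} + ‖g‖_{L^∞(Ω∩B₄)})`, where `C` depends only
on `n`, `s` and the local `C^{1,1}` norm of `∂Ω` (encoded by the two-sided ball radius `ρ`). -/
theorem boundary_Calpha0_regularity
    (n : ℕ) (hn : 1 ≤ n) (s : ℝ) (hs0 : 0 < s) (hs1 : s < 1) (ρ : ℝ) (hρ : 0 < ρ) :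
    ∃ C : ℝ, 0 < C ∧
      ∀ (Ω : Set (Euc n)), IsOpen Ω → IsConnected Ω →
        ∀ x₀ ∈ frontier Ω,
          (∀ z ∈ frontier Ω ∩ closedBall x₀ 4, TwoSidedBallAt n Ω ρ z) →
          ∀ (u g : Euc n → ℝ) (Kg Ku : ℝ),
            (∀ x, 0 ≤ u x) →
            C11LocOn n u (Ω ∩ ball x₀ 4) →
            MemL2s n s u →
            (∀ x ∈ Ω ∩ ball x₀ 4, HasFracLapAt n s u x (g x)) →
            (∀ x ∈ ball x₀ 4 \ Ω, u x = 0) →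
            (∀ x ∈ Ω ∩ ball x₀ 4, |g x| ≤ Kg) →
            (∀ x ∈ Ω ∩ ball x₀ 4, u x ≤ Ku) →
            HolderBoundOn n (min s (1 - s)) u (Ω ∩ ball x₀ (1/2)) (C * (Ku + Kg)) := by
  set r := min ρ (1 / 16) with hr
  have hr0 : 0 < r := by positivity
  have hr1 : r ≤ 1 / 16 := min_le_right _ _
  obtain ⟨C₁, hC₁, htail⟩ := exists_tail_le (n := n) hn hs0 hs1 (r := r / 2) (by positivity)
    (by linarith)
  have hc := fracC_pos (n := n) hs0 hs1
  set A := 1 / fracC n s + 3 ^ ((n : ℝ) + 2 * s) * C₁ with hA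
  have hα0 : 0 < min s (1 - s) := lt_min hs0 (by linarith)
  have hα : min s (1 - s) ≤ 1 / 2 := by
    rcases min_cases s (1 - s) with h | h <;> linarith
  obtain ⟨L, hL0, hL⟩ := exists_holder_bound (n := n) hn hs0 hs1 hr0 hr1 A hα0 hα (min_le_left _ _)
  refine ⟨L + 1, by positivity, fun Ω hΩ _ x₀ hx₀ hball u g Kg Ku hu0 hC hu hpde hzero hKg hKu => ?_⟩
  have hpv : ∀ x ∈ Ω ∩ ball x₀ 4, HasPVAt n s u x (g x / fracC n s) := fun x hx =>
    (hpde x hx).hasPVAt hs0 hs1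
  obtain ⟨ν, hν, hin, -⟩ := (hball x₀ ⟨hx₀, mem_closedBall_self (by norm_num)⟩).mono
    (min_le_left ρ (1 / 16))
  rw [← hr] at hin
  set p := x₀ + r • ν with hp
  have hpx : ‖p - x₀‖ = r := by
    rw [hp, add_sub_cancel_left, norm_smul, hν, mul_one, Real.norm_of_nonneg hr0.le]
  have hpΩ : closedBall p (r / 2) ⊆ Ω ∩ ball x₀ 4 := fun y hy =>
    ⟨hin (closedBall_subset_ball (by linarith) hy), by
      have h1 := dist_triangle y p x₀
      rw [mem_closedBall] at hy
      rw [dist_eq_norm p, hpx] at h1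
      rw [mem_ball]
      linarith⟩
  have hpp := hpΩ (mem_closedBall_self (by positivity : 0 ≤ r / 2))
  have hKu0 : 0 ≤ Ku := (hu0 p).trans (hKu p hpp)
  have hKg0 : 0 ≤ Kg := (abs_nonneg _).trans (hKg p hpp)
  have hsub : Ω ∩ ball x₀ (1 / 2) ⊆ Ω ∩ ball x₀ 4 :=
    inter_subset_inter_right _ (ball_subset_ball (by norm_num))
  rcases (add_nonneg hKu0 hKg0).eq_or_lt with h0 | hM0
  · have hu00 : ∀ x ∈ Ω ∩ ball x₀ (1 / 2), u x = 0 := fun x hx =>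
      le_antisymm (by linarith [hKu x (hsub hx)]) (hu0 x)
    rw [← h0, mul_zero]
    exact ⟨fun x hx => by simp [hu00 x hx], fun x hx y hy => by simp [hu00 x hx, hu00 y hy]⟩
  set M := Ku + Kg with hM
  obtain ⟨q, hq, hqtail⟩ := htail u g p Kg Ku hu0 hu (hC.continuousOn.mono hpΩ)
    (fun x hx => hKu x (hpΩ hx)) (fun x hx => hKg x (hpΩ hx)) (fun x hx => hpv x (hpΩ hx))
  have hqx : ‖q - x₀‖ ≤ 1 / 8 := by
    have h1 := norm_sub_le_norm_sub_add_norm_sub q p x₀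
    rw [mem_closedBall, dist_eq_norm] at hq
    linarith
  set w := (ball x₀ 4)ᶜ.indicator u with hw
  have hw0 : ∀ y, 0 ≤ w y := fun y => indicator_nonneg (fun y _ => hu0 y) y
  have hfar : ∀ y, w y ≠ 0 → 4 ≤ ‖y - x₀‖ := fun y hy => by
    by_contra! h
    exact hy (indicator_of_notMem (not_not.2 (mem_ball.2 (by rwa [dist_eq_norm]))) u)
  have hqint := (hpv q (hpΩ hq)).indicator hn hs0 hs1 hu measurableSet_ball (δ := 1) one_pos
    (ball_subset_ball' (by rw [dist_eq_norm]; linarith) : ball q 1 ⊆ ball x₀ 4)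
  have hwq : ∫ z, w (q + z) * fracKer n s z ≤ C₁ * M := by
    refine le_trans ?_ hqtail
    rw [← integral_indicator (measurableSet_le_norm 1)]
    refine integral_mono hqint.1 ((integrable_indicator_iff (measurableSet_le_norm 1)).2
      (hu.integrableOn_ker hs0 q one_pos)) fun z => ?_
    rcases eq_or_ne (w (q + z)) 0 with h | h
    · simp only [h, zero_mul]
      exact indicator_nonneg (fun z _ => mul_nonneg (hu0 _) (fracKer_nonneg z)) z
    · have h1 := hfar _ h
      have h2 : ‖q + z - x₀‖ ≤ ‖q - x₀‖ + ‖z‖ := by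
        rw [add_sub_right_comm]; exact norm_add_le _ _
      have h3 : z ∈ {z : Euc n | 1 ≤ ‖z‖} := show 1 ≤ ‖z‖ by linarith
      rw [indicator_of_mem h3]
      exact mul_le_mul_of_nonneg_right (indicator_le_self' (fun y _ => hu0 y) _) (fracKer_nonneg z)
  have hP : BoundaryProblem n s A Ω x₀ r fun y => (ball x₀ 4).indicator u y / M := by
    have h24 : ball x₀ 2 ⊆ ball x₀ 4 := ball_subset_ball (by norm_num)
    refine ⟨hΩ, fun h => ?_, fun z hz => ?_, ?_, fun y => ?_, ?_, fun x hx => ?_, fun x hx => ?_⟩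
    · exact hx₀.2 (hΩ.interior_eq.symm ▸ h)
    · exact (hball z ⟨hz.1, ball_subset_closedBall (h24 hz.2)⟩).mono (min_le_left _ _)
    · simp only [div_eq_mul_inv]
      exact (hu.1.aestronglyMeasurable.indicator measurableSet_ball).mul_const _
    · refine ⟨div_nonneg (indicator_nonneg (fun y _ => hu0 y) y) hM0.le, ?_⟩
      rw [div_le_one hM0]
      refine indicator_le' (fun y hy => ?_) (fun _ _ => hM0.le) y
      by_cases h : y ∈ Ω
      · linarith [hKu y ⟨h, hy⟩]
      · rw [hzero y ⟨hy, h⟩]; exact hM0.le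
    · refine ((hC.continuousOn.mono (inter_subset_inter_right _ h24)).congr fun y hy => ?_).div_const _
      exact indicator_of_mem (h24 hy.2) u
    · rw [indicator_of_mem (h24 hx.1), hzero x ⟨h24 hx.1, hx.2⟩, zero_div]
    · have hx4 : x ∈ Ω ∩ ball x₀ 4 := ⟨hx.1, h24 hx.2⟩
      have hx2 : ‖x - x₀‖ < 2 := by simpa [dist_eq_norm] using hx.2
      obtain ⟨hint, hpvx⟩ := (hpv x hx4).indicator hn hs0 hs1 hu measurableSet_ball (δ := 1) one_pos
        (ball_subset_ball' (by rw [dist_eq_norm]; linarith) : ball x 1 ⊆ ball x₀ 4)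
      rw [← hw] at hint hpvx
      have hle : ∫ z, w (x + z) * fracKer n s z ≤ 3 ^ ((n : ℝ) + 2 * s) * (C₁ * M) := by
        refine (integral_tail_le_of_norm_le hs0 hw0 (c := 3) (by norm_num) hint hqint.1
          fun y hy => ?_).trans (by gcongr)
        have h4 := hfar y hy
        have h5 := norm_sub_le_norm_sub_add_norm_sub y x x₀
        have h6 := norm_sub_le_norm_sub_add_norm_sub y q x₀
        have h7 := norm_sub_le_norm_sub_add_norm_sub y x q
        have h8 := norm_sub_le_norm_sub_add_norm_sub x x₀ q
        rw [norm_sub_rev x₀ q] at h8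
        constructor <;> linarith
      have hge : 0 ≤ ∫ z, w (x + z) * fracKer n s z :=
        integral_nonneg fun z => mul_nonneg (hw0 _) (fracKer_nonneg z)
      refine ⟨(g x / fracC n s + ∫ z, w (x + z) * fracKer n s z) / M, ?_, ?_⟩
      · rw [abs_div, abs_of_pos hM0, div_le_iff₀ hM0]
        refine (abs_add_le _ _).trans ?_
        rw [abs_of_nonneg hge, abs_div, abs_of_pos hc, hA, add_mul, mul_assoc _ C₁]
        refine add_le_add ?_ hle
        rw [div_mul_eq_mul_div, one_mul]
        gcongr
        linarith [hKg x hx4]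
      · refine (hpvx.div_const M).congr fun ε => ?_
        rw [← integral_div]
        congr 1 with z
        ring
  have hmain : ∀ x ∈ Ω ∩ ball x₀ (1 / 2), ∀ y ∈ Ω ∩ ball x₀ (1 / 2),
      u x - u y ≤ (L + 1) * M * dist x y ^ min s (1 - s) := fun x hx y hy => by
    have h1 := hL Ω x₀ _ hP x hx.2 y hy.2
    simp only [indicator_of_mem (hsub hx).2, indicator_of_mem (hsub hy).2] at h1
    rw [← sub_div, div_le_iff₀ hM0, ← dist_eq_norm] at h1
    have h2 : 0 ≤ M * dist x y ^ min s (1 - s) := by positivity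
    linarith
  refine ⟨fun x hx => ?_, fun x hx y hy => abs_le'.2 ⟨hmain x hx y hy, ?_⟩⟩
  · rw [abs_of_nonneg (hu0 x)]
    have := hKu x (hsub hx)
    have := mul_nonneg hL0.le hM0.le
    linarith
  · rw [neg_sub, dist_comm]
    exact hmain y hy x hx
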